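/- arXiv:1908.03384 — 2 statements merged into one kernel-verified Lean document; each statement's English description precedes it below -/
import Mathlib

section
/- Let n ≥ 2 and m ∈ ℕ with 1 ≤ m < n, and let ρ be a rearrangement-invariant function norm on (0,∞) with associate norm ρ'. Define σ_m(f) = ρ'(t ↦ t^{m/n} f^{**}(t)) for nonnegative measurable f on (0,∞). Then σ_m is itself a rearrangement-invariant function norm on (0,∞) if and only if ρ'(t ↦ t^{m/n−1} χ_{(1,∞)}(t)) < ∞. -/
open MeasureTheory Set Filter
open scoped ENNReal NNReal Topology

noncomputable section

/-- Lebesgue measure restricted to `(0,∞)`. -/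
def mu0 : Measure ℝ := volume.restrict (Set.Ioi (0:ℝ))

/-- Decreasing rearrangement of an `ℝ≥0∞`-valued function w.r.t. a measure `μ`. -/
def rearrangement {α : Type*} [MeasurableSpace α] (μ : Measure α) (f : α → ℝ≥0∞) (t : ℝ) :
    ℝ≥0∞ :=
  sInf {l : ℝ≥0∞ | μ {x | l < f x} ≤ ENNReal.ofReal t}

/-- Decreasing rearrangement of a (nonnegative) function on `(0,∞)`. -/
def rearr (f : ℝ → ℝ≥0∞) : ℝ → ℝ≥0∞ := rearrangement mu0 f

/-- The maximal rearrangement `f^{**}(t) = (1/t)∫_0^t f^*(s) ds`. -/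
def doubleStar (f : ℝ → ℝ≥0∞) (t : ℝ) : ℝ≥0∞ :=
  (ENNReal.ofReal t)⁻¹ * ∫⁻ s in Set.Ioc (0:ℝ) t, rearr f s

/-- Rearrangement-invariant function norm on `(0,∞)` (axioms (P1)–(P6)). -/
structure IsRINorm (ρ : (ℝ → ℝ≥0∞) → ℝ≥0∞) : Prop where
  eq_zero_iff : ∀ f : ℝ → ℝ≥0∞, Measurable f → (ρ f = 0 ↔ f =ᵐ[mu0] 0)
  smul : ∀ (c : ℝ≥0) (f : ℝ → ℝ≥0∞), Measurable f →
    ρ (fun t => (c : ℝ≥0∞) * f t) = c * ρ f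
  triangle : ∀ f g : ℝ → ℝ≥0∞, Measurable f → Measurable g → ρ (f + g) ≤ ρ f + ρ g
  mono : ∀ f g : ℝ → ℝ≥0∞, Measurable f → Measurable g →
    (∀ᵐ t ∂mu0, f t ≤ g t) → ρ f ≤ ρ g
  fatou : ∀ (F : ℕ → ℝ → ℝ≥0∞) (f : ℝ → ℝ≥0∞), (∀ j, Measurable (F j)) → Measurable f →
    (∀ j t, F j t ≤ F (j + 1) t) → (∀ t, (⨆ j, F j t) = f t) → (⨆ j, ρ (F j)) = ρ f
  indicator_lt_top : ∀ E : Set ℝ, MeasurableSet E → mu0 E < ∞ → ρ (E.indicator 1) < ∞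
  local_L1 : ∀ E : Set ℝ, MeasurableSet E → mu0 E < ∞ → ∃ C : ℝ≥0∞, 0 < C ∧ C < ∞ ∧
    ∀ f : ℝ → ℝ≥0∞, Measurable f → (∫⁻ t in E, f t ∂mu0) ≤ C * ρ f
  rearr_inv : ∀ f g : ℝ → ℝ≥0∞, Measurable f → Measurable g → rearr f = rearr g → ρ f = ρ g

/-- The associate norm `ρ'`. -/
def associate (ρ : (ℝ → ℝ≥0∞) → ℝ≥0∞) (g : ℝ → ℝ≥0∞) : ℝ≥0∞ :=
  ⨆ (f : ℝ → ℝ≥0∞) (_ : Measurable f) (_ : ρ f ≤ 1), ∫⁻ t, f t * g t ∂mu0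

/-- The weighted Hardy-type operator `f ↦ (t ↦ ∫_t^∞ f(s) s^{m/n-1} ds)`. -/
def hardyOp (m n : ℕ) (f : ℝ → ℝ≥0∞) (t : ℝ) : ℝ≥0∞ :=
  ∫⁻ s in Set.Ioi t, f s * ENNReal.ofReal (s ^ ((m : ℝ)/(n : ℝ) - 1))

/-- The function `t ↦ t^{m/n-1} χ_{(1,∞)}(t)`. -/
def tailFun (m n : ℕ) (t : ℝ) : ℝ≥0∞ :=
  ENNReal.ofReal (t ^ ((m : ℝ)/(n : ℝ) - 1)) * (Set.Ioi (1:ℝ)).indicator 1 t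

/-- The functional `σ_m(f) = ρ'(t ↦ t^{m/n} f^{**}(t))`. -/
def sigmaFun (m n : ℕ) (ρ : (ℝ → ℝ≥0∞) → ℝ≥0∞) (f : ℝ → ℝ≥0∞) : ℝ≥0∞ :=
  associate ρ (fun t => ENNReal.ofReal (t ^ ((m : ℝ)/(n : ℝ))) * doubleStar f t)

/-- The optimal-domain functional `τ_m`. -/
def tauFun (m n : ℕ) (ρY : (ℝ → ℝ≥0∞) → ℝ≥0∞) (f : ℝ → ℝ≥0∞) : ℝ≥0∞ :=
  ⨆ (h : ℝ → ℝ≥0∞) (_ : Measurable h) (_ : rearr h = rearr f), ρY (hardyOp m n h)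

/-- The operator `T_α f(t) = t^{-α} sup_{t ≤ s} s^α f^*(s)`. -/
def supOp (α : ℝ) (f : ℝ → ℝ≥0∞) (t : ℝ) : ℝ≥0∞ :=
  ENNReal.ofReal (t ^ (-α)) * ⨆ (s : ℝ) (_ : t ≤ s), ENNReal.ofReal (s ^ α) * rearr f s

/-- `σ` is an optimal (smallest) rearrangement-invariant target norm for `ρX` in the
Hardy-type inequality `‖∫_t^∞ f(s) s^{m/n-1} ds‖_Y ≤ C ‖f‖_X`. -/
def IsOptimalTargetNorm (m n : ℕ) (ρX σ : (ℝ → ℝ≥0∞) → ℝ≥0∞) : Prop :=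
  (∃ C : ℝ≥0∞, 0 < C ∧ C < ∞ ∧
      ∀ f : ℝ → ℝ≥0∞, Measurable f → σ (hardyOp m n f) ≤ C * ρX f) ∧
  ∀ ρZ : (ℝ → ℝ≥0∞) → ℝ≥0∞, IsRINorm ρZ →
    (∃ C : ℝ≥0∞, 0 < C ∧ C < ∞ ∧
       ∀ f : ℝ → ℝ≥0∞, Measurable f → ρZ (hardyOp m n f) ≤ C * ρX f) →
    ∃ c : ℝ≥0∞, 0 < c ∧ c < ∞ ∧ ∀ f : ℝ → ℝ≥0∞, Measurable f → ρZ f ≤ c * σ f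

/-- There exists a rearrangement-invariant target norm for `ρX` in the Hardy-type
inequality. -/
def ExistsRITarget (m n : ℕ) (ρX : (ℝ → ℝ≥0∞) → ℝ≥0∞) : Prop :=
  ∃ (ρY : (ℝ → ℝ≥0∞) → ℝ≥0∞) (C : ℝ≥0∞), IsRINorm ρY ∧ 0 < C ∧ C < ∞ ∧
    ∀ f : ℝ → ℝ≥0∞, Measurable f → ρY (hardyOp m n f) ≤ C * ρX f

/-- There exists a rearrangement-invariant domain norm for `ρY` in the Hardy-type
inequality. -/
def ExistsRIDomain (m n : ℕ) (ρY : (ℝ → ℝ≥0∞) → ℝ≥0∞) : Prop :=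
  ∃ (ρX : (ℝ → ℝ≥0∞) → ℝ≥0∞) (C : ℝ≥0∞), IsRINorm ρX ∧ 0 < C ∧ C < ∞ ∧
    ∀ f : ℝ → ℝ≥0∞, Measurable f → ρY (hardyOp m n f) ≤ C * ρX f

/-- Two functionals are equivalent with constants independent of the function. -/
def EquivNorms (σ τ : (ℝ → ℝ≥0∞) → ℝ≥0∞) : Prop :=
  ∃ c C : ℝ≥0∞, 0 < c ∧ c < ∞ ∧ 0 < C ∧ C < ∞ ∧
    ∀ f : ℝ → ℝ≥0∞, Measurable f → c * σ f ≤ τ f ∧ τ f ≤ C * σ f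

/-- The decay condition defining `V_0^m X(ℝ^n)`: all derivatives of order `< m` have
finite-measure superlevel sets. -/
def DecaysAtInfinity (n m : ℕ) (u : EuclideanSpace ℝ (Fin n) → ℝ) : Prop :=
  ∀ k : ℕ, k < m → ∀ lam : ℝ, 0 < lam →
    volume {x : EuclideanSpace ℝ (Fin n) | lam < ‖iteratedFDeriv ℝ k u x‖} < ∞

/-- Broken logarithm `ℓ^{[a₀,a_∞]}`. -/
def ell (a0 ai : ℝ) (t : ℝ) : ℝ :=
  if t < 1 then (1 - Real.log t) ^ a0 else (1 + Real.log t) ^ ai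

/-- Doubly broken logarithm `ℓℓ^{[b₀,b_∞]}`. -/
def ell2 (b0 bi : ℝ) (t : ℝ) : ℝ :=
  if t < 1 then (1 + Real.log (1 - Real.log t)) ^ b0
  else (1 + Real.log (1 + Real.log t)) ^ bi

/-- Triply broken logarithm `ℓℓℓ^{[c₀,c_∞]}`. -/
def ell3 (c0 ci : ℝ) (t : ℝ) : ℝ :=
  if t < 1 then (1 + Real.log (1 + Real.log (1 - Real.log t))) ^ c0
  else (1 + Real.log (1 + Real.log (1 + Real.log t))) ^ ci

/-- `L^q`-functional (`q ∈ [1,∞]`) of an `ℝ≥0∞`-valued function over `S ⊆ ℝ`. -/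
def Lqnorm (q : ℝ≥0∞) (S : Set ℝ) (g : ℝ → ℝ≥0∞) : ℝ≥0∞ :=
  if q = ∞ then essSup g (volume.restrict S)
  else (∫⁻ t in S, g t ^ q.toReal) ^ (1 / q.toReal)

/-- Lorentz–Zygmund functional `‖f‖_{p,q;[a₀,a_∞]}`, parametrized by `pinv = 1/p`. -/
def LZnorm (pinv : ℝ) (q : ℝ≥0∞) (a0 ai : ℝ) (f : ℝ → ℝ≥0∞) : ℝ≥0∞ :=
  Lqnorm q (Set.Ioi 0)
    (fun t => ENNReal.ofReal (t ^ (pinv - q⁻¹.toReal) * ell a0 ai t) * rearr f t)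

/-- Generalized Lorentz–Zygmund functional with two tiers of logarithms. -/
def GLZnorm2 (pinv : ℝ) (q : ℝ≥0∞) (a0 ai b0 bi : ℝ) (f : ℝ → ℝ≥0∞) : ℝ≥0∞ :=
  Lqnorm q (Set.Ioi 0)
    (fun t => ENNReal.ofReal (t ^ (pinv - q⁻¹.toReal) * ell a0 ai t * ell2 b0 bi t) * rearr f t)

/-- Generalized Lorentz–Zygmund functional with three tiers of logarithms. -/
def GLZnorm3 (pinv : ℝ) (q : ℝ≥0∞) (a0 ai b0 bi c0 ci : ℝ) (f : ℝ → ℝ≥0∞) : ℝ≥0∞ :=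
  Lqnorm q (Set.Ioi 0)
    (fun t => ENNReal.ofReal
      (t ^ (pinv - q⁻¹.toReal) * ell a0 ai t * ell2 b0 bi t * ell3 c0 ci t) * rearr f t)

/-- Young function predicate. -/
structure IsYoung (A : ℝ → ℝ≥0∞) : Prop where
  map_zero : A 0 = 0
  convex : ∀ x y : ℝ, 0 ≤ x → 0 ≤ y → ∀ l : ℝ, 0 ≤ l → l ≤ 1 →
    A (l * x + (1 - l) * y) ≤ ENNReal.ofReal l * A x + ENNReal.ofReal (1 - l) * A y
  left_cont : ∀ x : ℝ, 0 < x → Filter.Tendsto A (nhdsWithin x (Set.Iio x)) (nhds (A x))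
  not_zero : ∃ x : ℝ, 0 < x ∧ A x ≠ 0
  not_top : ∃ x : ℝ, 0 < x ∧ A x ≠ ∞

/-- Canonical extension of a Young function to `ℝ≥0∞`-valued arguments. -/
def eext (A : ℝ → ℝ≥0∞) (x : ℝ≥0∞) : ℝ≥0∞ := if x = ∞ then ∞ else A x.toReal

/-- Luxemburg norm on `(0,∞)`. -/
def luxNorm (A : ℝ → ℝ≥0∞) (f : ℝ → ℝ≥0∞) : ℝ≥0∞ :=
  sInf {l : ℝ≥0∞ | l ≠ 0 ∧ (∫⁻ t in Set.Ioi (0:ℝ), eext A (f t / l)) ≤ 1}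

/-- Generalized (right-continuous) inverse of a nondecreasing `g : ℝ → ℝ≥0∞`. -/
def geninv (g : ℝ → ℝ≥0∞) (y : ℝ≥0∞) : ℝ≥0∞ :=
  ⨅ (s : ℝ) (_ : 0 ≤ s) (_ : y ≤ g s), ENNReal.ofReal s

/-- Young conjugate `Ã(t) = sup_{s ≥ 0} (st - A(s))`. -/
def conjY (A : ℝ → ℝ≥0∞) (t : ℝ) : ℝ≥0∞ :=
  ⨆ (s : ℝ) (_ : 0 ≤ s), (ENNReal.ofReal (s * t) - A s)

/-- `h_A(t) = sup_{0<s<∞} A^{-1}(st)/A^{-1}(s)`. -/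
def hYoung (A : ℝ → ℝ≥0∞) (t : ℝ) : ℝ≥0∞ :=
  ⨆ (s : ℝ) (_ : 0 < s), geninv A (ENNReal.ofReal (s * t)) / geninv A (ENNReal.ofReal s)

/-- The upper Boyd index `I_A = inf_{0<t<1} log t / log h_A(t)`. -/
def upperBoyd (A : ℝ → ℝ≥0∞) : ℝ :=
  sInf ((fun t => Real.log t / Real.log ((hYoung A t).toReal)) '' Set.Ioo (0:ℝ) 1)

/-- `H_m(t) = (∫_0^t (s/A(s))^{m/(n-m)} ds)^{(n-m)/n}`. -/
def Hm (m n : ℕ) (A : ℝ → ℝ≥0∞) (t : ℝ) : ℝ≥0∞ :=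
  (∫⁻ s in Set.Ioc (0:ℝ) t, (ENNReal.ofReal s / A s) ^ ((m : ℝ)/((n : ℝ) - (m : ℝ))))
    ^ (((n : ℝ) - (m : ℝ))/(n : ℝ))

/-- `H^∞ = lim_{t→∞} H_m(t)`. -/
def Hinfty (m n : ℕ) (A : ℝ → ℝ≥0∞) : ℝ≥0∞ := ⨆ t : ℝ, Hm m n A t

/-- `D_m`. -/
def Dm (m n : ℕ) (A : ℝ → ℝ≥0∞) (t : ℝ) : ℝ≥0∞ :=
  if ENNReal.ofReal t < Hinfty m n A then
    (ENNReal.ofReal t * A ((geninv (Hm m n A) (ENNReal.ofReal t)).toReal) /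
        geninv (Hm m n A) (ENNReal.ofReal t)) ^ ((n : ℝ)/((n : ℝ) - (m : ℝ)))
  else ∞

/-- `A_m(t) = ∫_0^t D_m(s)/s ds`. -/
def Am (m n : ℕ) (A : ℝ → ℝ≥0∞) (t : ℝ) : ℝ≥0∞ :=
  ∫⁻ s in Set.Ioc (0:ℝ) t, Dm m n A s / ENNReal.ofReal s

/-- `G_m(t) = t · inf_{0<s≤t} B^{-1}(s) s^{(m-n)/n}`. -/
def Gm (m n : ℕ) (B : ℝ → ℝ≥0∞) (t : ℝ) : ℝ≥0∞ :=
  ENNReal.ofReal t *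
    ⨅ (s : ℝ) (_ : 0 < s) (_ : s ≤ t),
      geninv B (ENNReal.ofReal s) * ENNReal.ofReal (s ^ (((m : ℝ) - (n : ℝ))/(n : ℝ)))

/-- `B_m(t) = ∫_0^t G_m^{-1}(s)/s ds`. -/
def Bm (m n : ℕ) (B : ℝ → ℝ≥0∞) (t : ℝ) : ℝ≥0∞ :=
  ∫⁻ s in Set.Ioc (0:ℝ) t, geninv (Gm m n B) (ENNReal.ofReal s) / ENNReal.ofReal s

/-- `A` dominates `B` near zero. -/
def DomNearZero (A B : ℝ → ℝ≥0∞) : Prop :=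
  ∃ c t0 : ℝ, 0 < c ∧ 0 < t0 ∧ ∀ t : ℝ, 0 ≤ t → t ≤ t0 → B t ≤ A (c * t)

/-- `A` dominates `B` near infinity. -/
def DomNearInfty (A B : ℝ → ℝ≥0∞) : Prop :=
  ∃ c t0 : ℝ, 0 < c ∧ 0 < t0 ∧ ∀ t : ℝ, t0 ≤ t → B t ≤ A (c * t)

def EquivNearZero (A B : ℝ → ℝ≥0∞) : Prop := DomNearZero A B ∧ DomNearZero B A

def EquivNearInfty (A B : ℝ → ℝ≥0∞) : Prop := DomNearInfty A B ∧ DomNearInfty B A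

/-- There exists an Orlicz target for the Hardy-type inequality with domain `L^A`. -/
def ExistsOrliczTarget (m n : ℕ) (A : ℝ → ℝ≥0∞) : Prop :=
  ∃ B : ℝ → ℝ≥0∞, IsYoung B ∧ ∃ C : ℝ≥0∞, 0 < C ∧ C < ∞ ∧
    ∀ f : ℝ → ℝ≥0∞, Measurable f → luxNorm B (hardyOp m n f) ≤ C * luxNorm A f

/-- There exists an Orlicz domain for the Hardy-type inequality with target `L^B`. -/
def ExistsOrliczDomain (m n : ℕ) (B : ℝ → ℝ≥0∞) : Prop :=
  ∃ A : ℝ → ℝ≥0∞, IsYoung A ∧ ∃ C : ℝ≥0∞, 0 < C ∧ C < ∞ ∧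
    ∀ f : ℝ → ℝ≥0∞, Measurable f → luxNorm B (hardyOp m n f) ≤ C * luxNorm A f

/-- `L^{A_m}` is the optimal (smallest) Orlicz target for `L^A`. -/
def IsOptimalOrliczTarget (m n : ℕ) (A B : ℝ → ℝ≥0∞) : Prop :=
  (∃ C : ℝ≥0∞, 0 < C ∧ C < ∞ ∧
      ∀ f : ℝ → ℝ≥0∞, Measurable f → luxNorm B (hardyOp m n f) ≤ C * luxNorm A f) ∧
  ∀ B' : ℝ → ℝ≥0∞, IsYoung B' →
    (∃ C : ℝ≥0∞, 0 < C ∧ C < ∞ ∧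
       ∀ f : ℝ → ℝ≥0∞, Measurable f → luxNorm B' (hardyOp m n f) ≤ C * luxNorm A f) →
    ∃ c : ℝ≥0∞, 0 < c ∧ c < ∞ ∧
      ∀ g : ℝ → ℝ≥0∞, Measurable g → luxNorm B' g ≤ c * luxNorm B g

/-- Model Young-function behaviour `t^p (1 - log t)^a` (near zero). -/
def modelZero (p a : ℝ) (t : ℝ) : ℝ≥0∞ := ENNReal.ofReal (t ^ p * (1 - Real.log t) ^ a)

/-- Model Young-function behaviour `t^p (1 + log t)^a` (near infinity). -/
def modelInf (p a : ℝ) (t : ℝ) : ℝ≥0∞ := ENNReal.ofReal (t ^ p * (1 + Real.log t) ^ a)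

/-! ### Layer cake and rearrangements -/

lemma vol_layer (a : ℝ≥0∞) : volume {l : ℝ | 0 < l ∧ ENNReal.ofReal l < a} = a := by
  rcases eq_or_ne a ∞ with rfl | ha
  · have : {l : ℝ | 0 < l ∧ ENNReal.ofReal l < ∞} = Ioi 0 := by
      ext l; simp
    rw [this, Real.volume_Ioi]
  · have : {l : ℝ | 0 < l ∧ ENNReal.ofReal l < a} = Ioo 0 a.toReal := by
      ext l
      simp only [mem_ofPred_eq, mem_Ioo]
      refine and_congr_right fun h => ?_
      rw [ENNReal.ofReal_lt_iff_lt_toReal h.le ha]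
    rw [this, Real.volume_Ioo, sub_zero, ENNReal.ofReal_toReal ha]

instance : SFinite mu0 := by unfold mu0; infer_instance

lemma layer_cake (f : ℝ → ℝ≥0∞) (hf : Measurable f) :
    ∫⁻ x, f x ∂mu0 = ∫⁻ l in Ioi (0:ℝ), mu0 {x | ENNReal.ofReal l < f x} := by
  have hS : MeasurableSet {p : ℝ × ℝ | ENNReal.ofReal p.2 < f p.1} :=
    measurableSet_lt (ENNReal.measurable_ofReal.comp measurable_snd) (hf.comp measurable_fst)
  have h1 : (mu0.prod (volume.restrict (Ioi (0:ℝ)))) {p : ℝ × ℝ | ENNReal.ofReal p.2 < f p.1}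
      = ∫⁻ x, f x ∂mu0 := by
    rw [Measure.prod_apply hS]
    refine lintegral_congr fun x => ?_
    rw [Measure.restrict_apply (measurable_prodMk_left hS)]
    rw [← vol_layer (f x)]
    congr 1
    ext l
    simp [and_comm]
  rw [← h1, Measure.prod_apply_symm hS]
  rfl

lemma lintegral_eq_of_equi (f g : ℝ → ℝ≥0∞) (hf : Measurable f) (hg : Measurable g)
    (h : ∀ l : ℝ≥0∞, mu0 {x | l < f x} = mu0 {x | l < g x}) :
    ∫⁻ x, f x ∂mu0 = ∫⁻ x, g x ∂mu0 := by
  rw [layer_cake f hf, layer_cake g hg]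
  simp only [h]

lemma lt_rearr_iff (f : ℝ → ℝ≥0∞) (l : ℝ≥0∞) (s : ℝ) :
    l < rearr f s ↔ ENNReal.ofReal s < mu0 {x | l < f x} := by
  constructor
  · intro h
    by_contra! hc
    exact absurd (sInf_le (show l ∈ {l : ℝ≥0∞ | mu0 {x | l < f x} ≤ ENNReal.ofReal s} from hc))
      (not_le.2 h)
  · intro h
    by_contra! hc
    have hl : l < ∞ := by
      rw [lt_top_iff_ne_top]; rintro rfl
      simp at h
    obtain ⟨u, hu1, hu2, hu3⟩ := exists_seq_strictAnti_tendsto' hl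
    have hU : {x | l < f x} = ⋃ n, {x | u n < f x} := by
      ext x
      simp only [mem_ofPred_eq, mem_iUnion]
      constructor
      · intro hx
        exact ((hu3.eventually (gt_mem_nhds hx)).exists)
      · rintro ⟨n, hn⟩
        exact (hu2 n).1.trans hn
    have hm : Monotone fun n => {x | u n < f x} := by
      intro a b hab x hx
      exact (hu1.antitone hab).trans_lt hx
    rw [hU, hm.measure_iUnion] at h
    obtain ⟨n, hn⟩ := lt_iSup_iff.1 h
    have : rearr f s < u n := hc.trans_lt (hu2 n).1
    obtain ⟨v, hv, hvu⟩ := sInf_lt_iff.1 this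
    have hv' : mu0 {x | v < f x} ≤ ENNReal.ofReal s := hv
    have : mu0 {x | u n < f x} ≤ mu0 {x | v < f x} := measure_mono fun x hx => hvu.trans hx
    exact absurd (this.trans hv') (not_le.2 hn)

lemma rearr_antitone (f : ℝ → ℝ≥0∞) : Antitone (rearr f) := by
  intro s t hst
  refine le_of_forall_lt fun l hl => ?_
  rw [lt_rearr_iff] at *
  exact (ENNReal.ofReal_le_ofReal hst).trans_lt hl

lemma rearr_meas (f : ℝ → ℝ≥0∞) : Measurable (rearr f) := (rearr_antitone f).measurable

lemma mu0_lt (a : ℝ≥0∞) : mu0 {s : ℝ | ENNReal.ofReal s < a} = a := by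
  unfold mu0
  rw [Measure.restrict_apply (measurableSet_lt ENNReal.measurable_ofReal measurable_const)]
  refine Eq.trans ?_ (vol_layer a)
  congr 1
  ext l
  simp [and_comm]

lemma rearr_equi (f : ℝ → ℝ≥0∞) (l : ℝ≥0∞) :
    mu0 {s | l < rearr f s} = mu0 {x | l < f x} := by
  simp only [lt_rearr_iff]
  exact mu0_lt _

lemma rearr_tsub_lintegral (f : ℝ → ℝ≥0∞) (hf : Measurable f) (c : ℝ≥0∞) :
    ∫⁻ s, (rearr f s - c) ∂mu0 = ∫⁻ s, (f s - c) ∂mu0 := by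
  refine lintegral_eq_of_equi _ _ ((rearr_meas f).sub_const c) (hf.sub_const c) fun l => ?_
  simp only [lt_tsub_iff_right]
  exact rearr_equi f (l + c)

lemma rearr_lintegral (f : ℝ → ℝ≥0∞) (hf : Measurable f) :
    ∫⁻ s, rearr f s ∂mu0 = ∫⁻ s, f s ∂mu0 :=
  lintegral_eq_of_equi _ _ (rearr_meas f) hf (rearr_equi f)

lemma lint_Ioc_le (g : ℝ → ℝ≥0∞) (t : ℝ) : ∫⁻ s in Ioc 0 t, g s ≤ ∫⁻ s, g s ∂mu0 :=
  lintegral_mono_set Ioc_subset_Ioi_self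

lemma K1 (f : ℝ → ℝ≥0∞) (hf : Measurable f) (t : ℝ) (c : ℝ≥0∞) :
    ∫⁻ s in Ioc 0 t, rearr f s ≤ ENNReal.ofReal t * c + ∫⁻ s, (f s - c) ∂mu0 := by
  calc ∫⁻ s in Ioc 0 t, rearr f s ≤ ∫⁻ s in Ioc 0 t, (c + (rearr f s - c)) :=
        lintegral_mono fun s => le_add_tsub
    _ = (∫⁻ s in Ioc 0 t, c) + ∫⁻ s in Ioc 0 t, (rearr f s - c) :=
        lintegral_add_left measurable_const _
    _ ≤ _ := by
        refine add_le_add ?_ ?_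
        · rw [setLIntegral_const, Real.volume_Ioc, sub_zero, mul_comm]
        · rw [← rearr_tsub_lintegral f hf]
          exact lint_Ioc_le _ _

lemma K2 (f : ℝ → ℝ≥0∞) (hf : Measurable f) (t : ℝ) :
    ENNReal.ofReal t * rearr f t + ∫⁻ s, (f s - rearr f t) ∂mu0
      ≤ ∫⁻ s in Ioc 0 t, rearr f s := by
  rw [← rearr_tsub_lintegral f hf]
  have h1 : ∫⁻ s, (rearr f s - rearr f t) ∂mu0 = ∫⁻ s in Ioc 0 t, (rearr f s - rearr f t) := by
    unfold mu0
    rw [← lintegral_indicator measurableSet_Ioi, ← lintegral_indicator measurableSet_Ioc]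
    refine lintegral_congr fun s => ?_
    by_cases h0 : 0 < s
    · by_cases h1 : s ≤ t
      · rw [indicator_of_mem (show s ∈ Ioi (0:ℝ) from h0),
          indicator_of_mem (show s ∈ Ioc 0 t from ⟨h0, h1⟩)]
      · rw [indicator_of_mem (show s ∈ Ioi (0:ℝ) from h0),
          indicator_of_notMem (show s ∉ Ioc 0 t from fun h => h1 h.2)]
        exact tsub_eq_zero_of_le (rearr_antitone f (not_le.1 h1).le)
    · rw [indicator_of_notMem (show s ∉ Ioi (0:ℝ) from h0),
          indicator_of_notMem (show s ∉ Ioc 0 t from fun h => h0 h.1)]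
  have h2 : ENNReal.ofReal t * rearr f t = ∫⁻ s in Ioc 0 t, rearr f t := by
    rw [setLIntegral_const, Real.volume_Ioc, sub_zero, mul_comm]
  rw [h1, h2, ← lintegral_add_left measurable_const]
  refine setLIntegral_mono (rearr_meas f) fun s hs => ?_
  rw [add_tsub_cancel_of_le (rearr_antitone f hs.2)]

lemma rearr_mono (f g : ℝ → ℝ≥0∞) (h : ∀ᵐ t ∂mu0, f t ≤ g t) (s : ℝ) :
    rearr f s ≤ rearr g s := by
  refine le_of_forall_lt fun l hl => ?_
  rw [lt_rearr_iff] at *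
  refine hl.trans_le (measure_mono_ae ?_)
  filter_upwards [h] with x hx hx2
  exact lt_of_lt_of_le hx2 hx

lemma int_rearr_add (f g : ℝ → ℝ≥0∞) (hf : Measurable f) (hg : Measurable g) (t : ℝ) :
    ∫⁻ s in Ioc 0 t, rearr (f + g) s
      ≤ (∫⁻ s in Ioc 0 t, rearr f s) + ∫⁻ s in Ioc 0 t, rearr g s := by
  refine le_trans ?_ (add_le_add (K2 f hf t) (K2 g hg t))
  refine (K1 (f + g) (hf.add hg) t (rearr f t + rearr g t)).trans ?_
  have : ∫⁻ s, ((f + g) s - (rearr f t + rearr g t)) ∂mu0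
      ≤ ∫⁻ s, (f s - rearr f t) ∂mu0 + ∫⁻ s, (g s - rearr g t) ∂mu0 := by
    rw [← lintegral_add_left (hf.sub_const _)]
    exact lintegral_mono fun s => add_tsub_add_le_tsub_add_tsub
  refine (add_le_add le_rfl this).trans (le_of_eq ?_)
  ring

lemma rearr_zero (s : ℝ) : rearr (fun _ => 0) s = 0 := by
  by_contra h
  have := (lt_rearr_iff (fun _ => 0) 0 s).1 (pos_iff_ne_zero.2 h)
  simp at this

lemma rearr_smul (c : ℝ≥0) (f : ℝ → ℝ≥0∞) (s : ℝ) :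
    rearr (fun t => (c : ℝ≥0∞) * f t) s = c * rearr f s := by
  rcases eq_or_ne c 0 with rfl | hc
  · simp [rearr_zero]
  · have hc' : (c : ℝ≥0∞) ≠ 0 := by simpa using hc
    have key : ∀ l y : ℝ≥0∞, l < c * y ↔ l / c < y := fun l y => by
      rw [ENNReal.div_lt_iff (Or.inl hc') (Or.inl ENNReal.coe_ne_top), mul_comm]
    refine eq_of_forall_lt_iff fun l => ?_
    rw [lt_rearr_iff]
    simp only [key]
    rw [lt_rearr_iff]

lemma rearr_iSup (F : ℕ → ℝ → ℝ≥0∞) (f : ℝ → ℝ≥0∞) (hm : ∀ j t, F j t ≤ F (j + 1) t)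
    (hs : ∀ t, (⨆ j, F j t) = f t) (s : ℝ) : rearr f s = ⨆ j, rearr (F j) s := by
  refine eq_of_forall_lt_iff fun l => ?_
  rw [lt_rearr_iff, lt_iSup_iff]
  simp only [lt_rearr_iff]
  have hU : {x | l < f x} = ⋃ n, {x | l < F n x} := by
    ext x
    simp only [mem_ofPred_eq, mem_iUnion, ← hs, lt_iSup_iff]
  have hmono : Monotone fun n => {x | l < F n x} := by
    refine monotone_nat_of_le_succ fun n x hx => ?_
    exact lt_of_lt_of_le hx (hm n x)
  rw [hU, hmono.measure_iUnion, lt_iSup_iff]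

lemma doubleStar_meas (f : ℝ → ℝ≥0∞) : Measurable (doubleStar f) := by
  unfold doubleStar
  refine (ENNReal.measurable_ofReal.inv).mul ?_
  refine Monotone.measurable fun s t hst => ?_
  exact lintegral_mono_set (Ioc_subset_Ioc_right hst)

lemma weight_meas (a : ℝ) : Measurable fun t : ℝ => ENNReal.ofReal (t ^ a) :=
  ENNReal.measurable_ofReal.comp (measurable_id.pow_const a)

/-! ### The associate functional -/

lemma assoc_mono (ρ : (ℝ → ℝ≥0∞) → ℝ≥0∞) (g h : ℝ → ℝ≥0∞) (H : ∀ t, 0 < t → g t ≤ h t) :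
    associate ρ g ≤ associate ρ h := by
  unfold associate
  refine iSup_mono fun f => iSup_mono fun _ => iSup_mono fun _ => ?_
  unfold mu0
  refine lintegral_mono_ae ?_
  filter_upwards [ae_restrict_mem measurableSet_Ioi] with t ht
  gcongr
  exact H t ht

lemma assoc_add (ρ : (ℝ → ℝ≥0∞) → ℝ≥0∞) (g h : ℝ → ℝ≥0∞) (hg : Measurable g) :
    associate ρ (fun t => g t + h t) ≤ associate ρ g + associate ρ h := by
  unfold associate
  refine iSup_le fun f => iSup_le fun hf => iSup_le fun hf1 => ?_
  simp only [mul_add]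
  rw [lintegral_add_left (show Measurable fun t => f t * g t from hf.mul hg)]
  refine add_le_add ?_ ?_
  · exact le_iSup_of_le f (le_iSup_of_le hf (le_iSup_of_le hf1 le_rfl))
  · exact le_iSup_of_le f (le_iSup_of_le hf (le_iSup_of_le hf1 le_rfl))

lemma assoc_smul (ρ : (ℝ → ℝ≥0∞) → ℝ≥0∞) (c : ℝ≥0∞) (hc : c ≠ ∞) (g : ℝ → ℝ≥0∞) :
    associate ρ (fun t => c * g t) = c * associate ρ g := by
  unfold associate
  simp only [ENNReal.mul_iSup]
  refine iSup_congr fun f => iSup_congr fun _ => iSup_congr fun _ => ?_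
  rw [← lintegral_const_mul' _ _ hc]
  refine lintegral_congr fun t => ?_
  ring

lemma le_assoc (ρ : (ℝ → ℝ≥0∞) → ℝ≥0∞) (f g : ℝ → ℝ≥0∞) (hf : Measurable f) (hf1 : ρ f ≤ 1) :
    ∫⁻ t, f t * g t ∂mu0 ≤ associate ρ g :=
  le_iSup_of_le f (le_iSup_of_le hf (le_iSup_of_le hf1 le_rfl))

lemma mu0_lt_top_of_Ioo (a b : ℝ) : mu0 (Ioc a b) < ∞ :=
  lt_of_le_of_lt (Measure.restrict_apply_le _ _) (by simp)

lemma assoc_ge (ρ : (ℝ → ℝ≥0∞) → ℝ≥0∞) (hρ : IsRINorm ρ) (E : Set ℝ) (hE : MeasurableSet E)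
    (hE' : mu0 E < ∞) : ∃ c : ℝ≥0, c ≠ 0 ∧ ∀ g : ℝ → ℝ≥0∞,
      (c : ℝ≥0∞) * ∫⁻ t in E, g t ∂mu0 ≤ associate ρ g := by
  have h1 := hρ.indicator_lt_top E hE hE'
  set r := (ρ (E.indicator 1)).toNNReal with hr
  have hr' : ρ (E.indicator 1) = r := (ENNReal.coe_toNNReal h1.ne).symm
  refine ⟨(r + 1)⁻¹, by positivity, fun g => ?_⟩
  have hm : Measurable (E.indicator (1 : ℝ → ℝ≥0∞)) := measurable_one.indicator hE
  have := le_assoc ρ (fun t => (((r + 1)⁻¹ : ℝ≥0) : ℝ≥0∞) * E.indicator 1 t) g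
    (hm.const_mul _) (by
      rw [hρ.smul _ _ hm, hr']
      rw [← ENNReal.coe_mul]
      rw [← ENNReal.coe_one, ENNReal.coe_le_coe, inv_mul_le_iff₀ (by positivity)]
      simp)
  refine le_trans (le_of_eq ?_) this
  rw [← lintegral_const_mul' _ _ ENNReal.coe_ne_top, ← lintegral_indicator hE]
  refine lintegral_congr fun t => ?_
  by_cases ht : t ∈ E <;> simp [ht]

/-! ### The functional `σ_m` -/

lemma sigma_zero_conv (m n : ℕ) (ρ : (ℝ → ℝ≥0∞) → ℝ≥0∞) (hρ : IsRINorm ρ) (f : ℝ → ℝ≥0∞)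
    (h : sigmaFun m n ρ f = 0) : f =ᵐ[mu0] 0 := by
  obtain ⟨c, hc, H⟩ := assoc_ge ρ hρ (Ioc 0 1) measurableSet_Ioc (mu0_lt_top_of_Ioo 0 1)
  have h1 := H (fun t => ENNReal.ofReal (t ^ ((m : ℝ)/(n : ℝ))) * doubleStar f t)
  change _ ≤ sigmaFun m n ρ f at h1
  rw [h, nonpos_iff_eq_zero, mul_eq_zero] at h1
  have h2 := h1.resolve_left (by simpa using hc)
  by_contra hne
  have hpos : 0 < mu0 {x | 0 < f x} := by
    rw [pos_iff_ne_zero]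
    intro h0
    apply hne
    have : {x | 0 < f x} = {x | ¬ (f x = (0 : ℝ → ℝ≥0∞) x)} := by
      ext x; simp [pos_iff_ne_zero]
    rw [this] at h0
    exact h0
  obtain ⟨q, hq0, hq⟩ := ENNReal.lt_iff_exists_nnreal_btwn.1 hpos
  have hq0' : (0:ℝ) < q := by simpa using hq0
  have hq' : 0 < rearr f q := by
    rw [lt_rearr_iff]; simpa using hq
  have hds : ∀ t : ℝ, 0 < t → 0 < doubleStar f t := by
    intro t ht
    unfold doubleStar
    refine ENNReal.mul_pos (by simp) ?_
    have hle : ∫⁻ s in Ioc 0 (min t q), rearr f q ≤ ∫⁻ s in Ioc 0 t, rearr f s := by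
      refine (setLIntegral_mono (rearr_meas f) fun s hs => ?_).trans
        (lintegral_mono_set (Ioc_subset_Ioc_right (min_le_left t q)))
      exact rearr_antitone f (hs.2.trans (min_le_right _ _))
    refine (lt_of_lt_of_le ?_ hle).ne'
    rw [setLIntegral_const, Real.volume_Ioc, sub_zero]
    exact ENNReal.mul_pos hq'.ne' (by simpa [ht, pos_iff_ne_zero] using hq0'.ne')
  have hmeas : Measurable fun t : ℝ =>
      ENNReal.ofReal (t ^ ((m : ℝ)/(n : ℝ))) * doubleStar f t :=
    (weight_meas _).mul (doubleStar_meas f)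
  rw [lintegral_eq_zero_iff hmeas] at h2
  have h3 : ∀ᵐ t ∂(mu0.restrict (Ioc 0 1)), False := by
    filter_upwards [h2, ae_restrict_mem measurableSet_Ioc] with t ht ht'
    have h4 : ENNReal.ofReal (t ^ ((m : ℝ)/(n : ℝ))) * doubleStar f t = 0 := ht
    refine (ENNReal.mul_pos ?_ (hds t ht'.1).ne').ne' h4
    simpa using Real.rpow_pos_of_pos ht'.1 _
  have h5 : (mu0.restrict (Ioc 0 1)) univ = 0 := by
    have h6 := ae_iff.1 h3
    simpa only [not_false_eq_true, setOf_true] using h6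
  unfold mu0 at h5
  rw [Measure.restrict_restrict measurableSet_Ioc, inter_eq_left.2 Ioc_subset_Ioi_self] at h5
  simp at h5

lemma sigma_fatou (m n : ℕ) (ρ : (ℝ → ℝ≥0∞) → ℝ≥0∞) (F : ℕ → ℝ → ℝ≥0∞) (f : ℝ → ℝ≥0∞)
    (hm : ∀ j t, F j t ≤ F (j + 1) t)
    (hs : ∀ t, (⨆ j, F j t) = f t) : (⨆ j, sigmaFun m n ρ (F j)) = sigmaFun m n ρ f := by
  have hmr : ∀ s, Monotone fun j => rearr (F j) s := fun s =>
    monotone_nat_of_le_succ fun j => rearr_mono _ _ (Eventually.of_forall (hm j)) s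
  have hmd : ∀ t, Monotone fun j => doubleStar (F j) t := fun t i j hij => by
    exact mul_le_mul' le_rfl (lintegral_mono fun s => hmr s hij)
  have hds : ∀ t, doubleStar f t = ⨆ j, doubleStar (F j) t := by
    intro t
    unfold doubleStar
    rw [← ENNReal.mul_iSup]
    congr 1
    rw [← lintegral_iSup (fun j => rearr_meas (F j)) (fun i j hij s => hmr s hij)]
    refine lintegral_congr fun s => rearr_iSup F f hm hs s
  unfold sigmaFun associate
  rw [iSup_comm]
  refine iSup_congr fun h => ?_
  rw [iSup_comm]
  refine iSup_congr fun hh => ?_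
  rw [iSup_comm]
  refine iSup_congr fun _ => ?_
  rw [← lintegral_iSup]
  · refine lintegral_congr fun t => ?_
    dsimp only
    rw [hds, ENNReal.mul_iSup, ENNReal.mul_iSup]
  · exact fun j => hh.mul ((weight_meas _).mul (doubleStar_meas _))
  · intro i j hij t
    have := hmd t hij
    dsimp only at this ⊢
    gcongr

lemma int_E_le (f : ℝ → ℝ≥0∞) (hf : Measurable f) (E : Set ℝ)
    (R : ℝ) (hR : mu0 E ≤ ENNReal.ofReal R) :
    ∫⁻ t in E, f t ∂mu0 ≤ ∫⁻ s in Ioc 0 R, rearr f s := by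
  refine le_trans ?_ (K2 f hf R)
  calc ∫⁻ t in E, f t ∂mu0 ≤ ∫⁻ t in E, (rearr f R + (f t - rearr f R)) ∂mu0 :=
        lintegral_mono fun s => le_add_tsub
    _ = ∫⁻ t in E, rearr f R ∂mu0 + ∫⁻ t in E, (f t - rearr f R) ∂mu0 :=
        lintegral_add_left measurable_const _
    _ ≤ _ := by
        refine add_le_add ?_ (setLIntegral_le_lintegral _ _)
        rw [setLIntegral_const, mul_comm]
        gcongr

lemma sigma_local (m n : ℕ) (hn : 0 < n) (hmn : m < n) (ρ : (ℝ → ℝ≥0∞) → ℝ≥0∞)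
    (hρ : IsRINorm ρ)
    (E : Set ℝ) (hE' : mu0 E < ∞) : ∃ C : ℝ≥0∞, 0 < C ∧ C < ∞ ∧
    ∀ f : ℝ → ℝ≥0∞, Measurable f → (∫⁻ t in E, f t ∂mu0) ≤ C * sigmaFun m n ρ f := by
  set R : ℝ := (mu0 E).toReal + 1 with hRdef
  have hR0 : 0 < R := by positivity
  have hR : mu0 E ≤ ENNReal.ofReal R := by
    rw [ENNReal.le_ofReal_iff_toReal_le hE'.ne hR0.le]; simp [hRdef]
  obtain ⟨c, hc, H⟩ := assoc_ge ρ hρ (Ioc R (R+1)) measurableSet_Ioc (mu0_lt_top_of_Ioo _ _)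
  set a : ℝ := (m:ℝ)/(n:ℝ) with ha
  set k : ℝ≥0∞ := ENNReal.ofReal (R ^ a) * (ENNReal.ofReal (R+1))⁻¹ with hk
  have hk0 : k ≠ 0 := by
    refine mul_ne_zero ?_ (by simp)
    simpa using Real.rpow_pos_of_pos hR0 _
  have hkt : k ≠ ∞ := ENNReal.mul_ne_top (by simp) (by simp; positivity)
  have hc0 : (c : ℝ≥0∞) ≠ 0 := by simpa using hc
  have hck0 : (c : ℝ≥0∞) * k ≠ 0 := mul_ne_zero hc0 hk0
  have hckt : (c : ℝ≥0∞) * k ≠ ∞ := ENNReal.mul_ne_top (by simp) hkt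
  refine ⟨(c * k)⁻¹, by simpa using hckt, by simpa [pos_iff_ne_zero] using hck0, fun f hf => ?_⟩
  refine (int_E_le f hf E R hR).trans ?_
  rw [mul_comm, ← div_eq_mul_inv, ENNReal.le_div_iff_mul_le (Or.inl hck0) (Or.inl hckt)]
  refine le_trans ?_ (H _)
  have hint : ∀ I : ℝ≥0∞, ∫⁻ _ in Ioc R (R+1), I ∂mu0 = I := fun I => by
    unfold mu0
    rw [Measure.restrict_restrict measurableSet_Ioc, inter_eq_left.2
      (show Ioc R (R+1) ⊆ Ioi 0 from fun x hx => hR0.trans hx.1), setLIntegral_const]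
    simp
  rw [mul_comm, mul_assoc]
  gcongr
  rw [← hint (k * _)]
  refine setLIntegral_mono ((weight_meas _).mul (doubleStar_meas _)) fun t ht => ?_
  unfold doubleStar
  rw [hk, mul_assoc]
  have hapos : 0 ≤ a := by positivity
  refine mul_le_mul' ?_ (mul_le_mul' ?_ ?_)
  · exact ENNReal.ofReal_le_ofReal (Real.rpow_le_rpow hR0.le ht.1.le hapos)
  · exact ENNReal.inv_le_inv.2 (ENNReal.ofReal_le_ofReal ht.2)
  · exact lintegral_mono_set (Ioc_subset_Ioc_right ht.1.le)

lemma weight_inv (a t : ℝ) (ht : 0 < t) :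
    ENNReal.ofReal (t ^ a) * (ENNReal.ofReal t)⁻¹ = ENNReal.ofReal (t ^ (a - 1)) := by
  rw [← ENNReal.ofReal_inv_of_pos ht, ← ENNReal.ofReal_mul (Real.rpow_nonneg ht.le _),
    Real.rpow_sub_one ht.ne', div_eq_mul_inv]

lemma sigma_indicator (m n : ℕ) (ρ : (ℝ → ℝ≥0∞) → ℝ≥0∞)
    (hρ : IsRINorm ρ) (ht : associate ρ (tailFun m n) < ∞)
    (E : Set ℝ) (hE : MeasurableSet E) (hE' : mu0 E < ∞) :
    sigmaFun m n ρ (E.indicator 1) < ∞ := by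
  have hm : Measurable (E.indicator (1 : ℝ → ℝ≥0∞)) := measurable_one.indicator hE
  set a : ℝ := (m:ℝ)/(n:ℝ) with ha
  have hapos : 0 ≤ a := by positivity
  have hI1 : ∀ t : ℝ, ∫⁻ s in Ioc 0 t, rearr (E.indicator 1) s ≤ mu0 E := fun t => by
    refine (lint_Ioc_le _ _).trans ?_
    rw [rearr_lintegral _ hm, lintegral_indicator_one hE]
  have hI2 : ∀ t : ℝ, ∫⁻ s in Ioc 0 t, rearr (E.indicator 1) s ≤ ENNReal.ofReal t := fun t => by
    refine (K1 _ hm t 1).trans (le_of_eq ?_)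
    have : ∀ s, E.indicator (1 : ℝ → ℝ≥0∞) s - 1 = 0 := fun s => by
      by_cases h : s ∈ E <;> simp [h]
    simp [this]
  have hb : sigmaFun m n ρ (E.indicator 1) ≤
      associate ρ (fun t => (Ioc (0:ℝ) 1).indicator 1 t + mu0 E * tailFun m n t) := by
    refine assoc_mono ρ _ _ fun t ht0 => ?_
    unfold doubleStar
    rcases le_or_gt t 1 with h1 | h1
    · refine le_trans ?_ le_self_add
      rw [indicator_of_mem (show t ∈ Ioc (0:ℝ) 1 from ⟨ht0, h1⟩)]
      refine (mul_le_mul' (ENNReal.ofReal_le_ofReal (Real.rpow_le_one ht0.le h1 hapos))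
        (mul_le_mul' le_rfl (hI2 t))).trans ?_
      rw [ENNReal.inv_mul_cancel (by simpa using ht0) (by simp)]
      simp
    · refine le_trans ?_ le_add_self
      unfold tailFun
      rw [indicator_of_mem (show t ∈ Ioi (1:ℝ) from h1), ← mul_assoc, weight_inv _ _ ht0,
        mul_comm]
      simp only [Pi.one_apply, mul_one]
      exact mul_le_mul' (hI1 t) le_rfl
  refine hb.trans_lt ((assoc_add ρ _ _ (measurable_one.indicator measurableSet_Ioc)).trans_lt ?_)
  rw [assoc_smul ρ _ hE'.ne]
  refine ENNReal.add_lt_top.2 ⟨?_, ENNReal.mul_lt_top hE' ht⟩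
  obtain ⟨C, -, hC, H⟩ := hρ.local_L1 (Ioc 0 1) measurableSet_Ioc (mu0_lt_top_of_Ioo 0 1)
  refine lt_of_le_of_lt ?_ hC
  unfold associate
  refine iSup_le fun f => iSup_le fun hf => iSup_le fun hf1 => ?_
  have : ∫⁻ t, f t * (Ioc (0:ℝ) 1).indicator 1 t ∂mu0 = ∫⁻ t in Ioc 0 1, f t ∂mu0 := by
    rw [← lintegral_indicator measurableSet_Ioc]
    refine lintegral_congr fun t => ?_
    by_cases h : t ∈ Ioc (0:ℝ) 1 <;> simp only [h, indicator_of_mem, indicator_of_notMem, not_false_eq_true, Pi.one_apply, mul_one, mul_zero]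
  rw [this]
  calc _ ≤ C * ρ f := H f hf
    _ ≤ C * 1 := by gcongr
    _ = C := mul_one C

lemma tail_le_sigma (m n : ℕ) (ρ : (ℝ → ℝ≥0∞) → ℝ≥0∞) :
    associate ρ (tailFun m n) ≤ sigmaFun m n ρ ((Ioc (0:ℝ) 1).indicator 1) := by
  refine assoc_mono ρ _ _ fun t ht0 => ?_
  unfold tailFun
  by_cases h1 : t ∈ Ioi (1:ℝ)
  swap
  · rw [indicator_of_notMem h1]; simp
  rw [indicator_of_mem h1]
  unfold doubleStar
  rw [← mul_assoc, weight_inv _ _ ht0]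
  refine mul_le_mul' le_rfl ?_
  have : ∫⁻ s in Ioo (0:ℝ) 1, (1:ℝ≥0∞) ≤
      ∫⁻ s in Ioc 0 t, rearr ((Ioc (0:ℝ) 1).indicator 1) s := by
    refine (setLIntegral_mono (rearr_meas _) fun s hs => ?_).trans
      (lintegral_mono_set (fun x hx => ⟨hx.1, hx.2.le.trans (le_of_lt h1)⟩))
    refine le_of_forall_lt fun l hl => ?_
    rw [lt_rearr_iff]
    have hset : Ioc (0:ℝ) 1 ⊆ {x | l < (Ioc (0:ℝ) 1).indicator 1 x} := fun x hx => by
      rw [mem_ofPred_eq, indicator_of_mem hx]; exact hl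
    refine lt_of_lt_of_le ?_ (measure_mono hset)
    unfold mu0
    rw [Measure.restrict_apply measurableSet_Ioc, inter_eq_left.2 Ioc_subset_Ioi_self,
      Real.volume_Ioc, sub_zero]
    exact (ENNReal.ofReal_lt_ofReal_iff one_pos).2 hs.2
  refine le_trans (le_of_eq ?_) this
  simp

lemma sigma_smul (m n : ℕ) (ρ : (ℝ → ℝ≥0∞) → ℝ≥0∞) (c : ℝ≥0) (f : ℝ → ℝ≥0∞) :
    sigmaFun m n ρ (fun t => (c : ℝ≥0∞) * f t) = c * sigmaFun m n ρ f := by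
  unfold sigmaFun
  rw [← assoc_smul ρ _ ENNReal.coe_ne_top]
  congr 1
  funext t
  unfold doubleStar
  simp only [rearr_smul]
  rw [lintegral_const_mul' _ _ ENNReal.coe_ne_top]
  ring

lemma sigma_triangle (m n : ℕ) (ρ : (ℝ → ℝ≥0∞) → ℝ≥0∞) (f g : ℝ → ℝ≥0∞)
    (hf : Measurable f) (hg : Measurable g) :
    sigmaFun m n ρ (f + g) ≤ sigmaFun m n ρ f + sigmaFun m n ρ g := by
  unfold sigmaFun
  refine le_trans ?_ (assoc_add ρ _ _ ((weight_meas _).mul (doubleStar_meas f)))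
  refine assoc_mono ρ _ _ fun t _ => ?_
  rw [← mul_add]
  unfold doubleStar
  rw [← mul_add]
  gcongr
  exact int_rearr_add f g hf hg t

lemma sigma_mono (m n : ℕ) (ρ : (ℝ → ℝ≥0∞) → ℝ≥0∞) (f g : ℝ → ℝ≥0∞)
    (h : ∀ᵐ t ∂mu0, f t ≤ g t) : sigmaFun m n ρ f ≤ sigmaFun m n ρ g := by
  refine assoc_mono ρ _ _ fun t _ => ?_
  unfold doubleStar
  gcongr
  exact rearr_mono f g h _

lemma sigma_zero (m n : ℕ) (ρ : (ℝ → ℝ≥0∞) → ℝ≥0∞) (f : ℝ → ℝ≥0∞)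
    (h : f =ᵐ[mu0] 0) : sigmaFun m n ρ f = 0 := by
  have h1 : sigmaFun m n ρ f ≤ sigmaFun m n ρ (fun _ => 0) := by
    refine sigma_mono m n ρ _ _ ?_
    filter_upwards [h] with t ht
    exact ht.le
  refine le_antisymm (h1.trans (le_of_eq ?_)) zero_le
  have := sigma_smul m n ρ 0 (fun _ => 0)
  simpa using this

/-- `σ_m` is a rearrangement-invariant function norm if and only if
`t^{m/n-1} χ_{(1,∞)} ∈ X'(0,∞)`. -/
theorem statement0 (n m : ℕ) (hn : 2 ≤ n) (hm : 1 ≤ m) (hmn : m < n)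
    (ρ : (ℝ → ℝ≥0∞) → ℝ≥0∞) (hρ : IsRINorm ρ) :
    IsRINorm (sigmaFun m n ρ) ↔ associate ρ (tailFun m n) < ∞ := by
  constructor
  · intro h
    exact (tail_le_sigma m n ρ).trans_lt
      (h.indicator_lt_top _ measurableSet_Ioc (mu0_lt_top_of_Ioo 0 1))
  · intro h
    exact
      { eq_zero_iff := fun f _ => ⟨sigma_zero_conv m n ρ hρ f, sigma_zero m n ρ f⟩
        smul := fun c f _ => sigma_smul m n ρ c f
        triangle := fun f g hf hg => sigma_triangle m n ρ f g hf hg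
        mono := fun f g _ _ hfg => sigma_mono m n ρ f g hfg
        fatou := fun F f _ _ hm hs => sigma_fatou m n ρ F f hm hs
        indicator_lt_top := fun E hE hE' => sigma_indicator m n ρ hρ h E hE hE'
        local_L1 := fun E _ hE' => sigma_local m n (by omega) hmn ρ hρ E hE'
        rearr_inv := fun f g _ _ hfg => by
          unfold sigmaFun doubleStar
          rw [hfg] }

end
end

section
/- Let n ≥ 2 and 1 ≤ m < n, and let ρ_Y be a rearrangement-invariant function norm on (0,∞) with fundamental function φ(t) = ρ_Y(χ_{(0,t)}). Assume inf_{1≤t<∞} t^{1−m/n} / φ(t) > 0. Define τ_m(f) = sup{ ρ_Y(t ↦ ∫_t^∞ h(s) s^{m/n−1} ds) : h ≥ 0 measurable on (0,∞) with h^* = f^* } for nonnegative measurable f on (0,∞). Then: (i) τ_m is a rearrangement-invariant function norm on (0,∞); (ii) ρ_Y(t ↦ ∫_t^∞ f(s) s^{m/n−1} ds) ≤ τ_m(f) for every nonnegative measurable f; (iii) if ρ_Z is any rearrangement-invariant function norm on (0,∞) such that ρ_Y(t ↦ ∫_t^∞ f(s) s^{m/n−1} ds) ≤ C ρ_Z(f)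 for some C and all nonnegative measurable f, then τ_m(f) ≤ C ρ_Z(f) for all nonnegative measurable f. Conversely, if inf_{1≤t<∞} t^{1−m/n}/φ(t) = 0, then there exists no rearrangement-invariant function norm ρ_X on (0,∞) such that ρ_Y(t ↦ ∫_t^∞ f(s) s^{m/n−1} ds) ≤ C ρ_X(f) holds for some C and all nonnegative measurable f. -/
open MeasureTheory Set Filter
open scoped ENNReal NNReal Topology

noncomputable section

/-! ### Basic facts on `mu0` and transport maps -/

lemma mu0_Iic (x : ℝ) : mu0 (Iic x) = ENNReal.ofReal x := by
  unfold mu0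
  rw [Measure.restrict_apply measurableSet_Iic, Iic_inter_Ioi, Real.volume_Ioc, sub_zero]

lemma mu0_inter_Iic_le (A : Set ℝ) (x : ℝ) : mu0 (A ∩ Iic x) ≤ ENNReal.ofReal x :=
  (measure_mono inter_subset_right).trans (mu0_Iic x).le

lemma mu0_inter_Iic_ne (A : Set ℝ) (x : ℝ) : mu0 (A ∩ Iic x) ≠ ∞ :=
  ((mu0_inter_Iic_le A x).trans_lt ENNReal.ofReal_lt_top).ne

lemma mu0_univ : mu0 univ = ∞ := by
  unfold mu0
  simp

/-- the cumulative mass function of a set -/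
def cumul (A : Set ℝ) (x : ℝ) : ℝ := (mu0 (A ∩ Iic x)).toReal

lemma ofReal_cumul (A : Set ℝ) (x : ℝ) : ENNReal.ofReal (cumul A x) = mu0 (A ∩ Iic x) :=
  ENNReal.ofReal_toReal (mu0_inter_Iic_ne A x)

lemma cumul_nonneg (A : Set ℝ) (x : ℝ) : 0 ≤ cumul A x := ENNReal.toReal_nonneg

lemma cumul_mono (A : Set ℝ) : Monotone (cumul A) := fun _ y hxy =>
  ENNReal.toReal_mono (mu0_inter_Iic_ne A y)
    (measure_mono (inter_subset_inter_right _ (Iic_subset_Iic.2 hxy)))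

lemma cumul_of_nonpos (A : Set ℝ) {x : ℝ} (hx : x ≤ 0) : cumul A x = 0 := by
  have := mu0_inter_Iic_le A x
  rw [ENNReal.ofReal_of_nonpos hx] at this
  unfold cumul
  rw [le_antisymm this bot_le]; rfl

lemma cumul_le_add (A : Set ℝ) {x y : ℝ} (hxy : x ≤ y) : cumul A y ≤ cumul A x + (y - x) := by
  have h1 : mu0 (A ∩ Iic y) ≤ mu0 (A ∩ Iic x) + ENNReal.ofReal (y - x) := by
    have : A ∩ Iic y ⊆ (A ∩ Iic x) ∪ Ioc x y := by
      intro z hz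
      rcases le_or_gt z x with h | h
      · exact Or.inl ⟨hz.1, h⟩
      · exact Or.inr ⟨h, hz.2⟩
    refine (measure_mono this).trans ((measure_union_le _ _).trans ?_)
    gcongr
    unfold mu0
    exact (Measure.restrict_apply_le _ _).trans (by rw [Real.volume_Ioc])
  have h2 := ENNReal.toReal_mono (by simp [mu0_inter_Iic_ne A x]) h1
  rwa [ENNReal.toReal_add (mu0_inter_Iic_ne A x) ENNReal.ofReal_ne_top,
    ENNReal.toReal_ofReal (by linarith)] at h2

lemma cumul_continuous (A : Set ℝ) : Continuous (cumul A) := by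
  have : LipschitzWith 1 (cumul A) := by
    apply LipschitzWith.of_dist_le_mul
    intro x y
    rw [NNReal.coe_one, one_mul, Real.dist_eq, Real.dist_eq, abs_le]
    rcases le_total x y with h | h
    · have h1 := cumul_mono A h
      have h2 := cumul_le_add A h
      rw [abs_of_nonpos (by linarith)]
      constructor <;> linarith
    · have h1 := cumul_mono A h
      have h2 := cumul_le_add A h
      rw [abs_of_nonneg (by linarith)]
      constructor <;> linarith
  exact this.continuous

lemma iSup_mu0_inter (A : Set ℝ) : ⨆ k : ℕ, mu0 (A ∩ Iic (k : ℝ)) = mu0 A := by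
  rw [← Monotone.measure_iUnion]
  · congr 1
    rw [← inter_iUnion]
    have : (⋃ k : ℕ, Iic (k : ℝ)) = univ := by
      ext x
      simpa using exists_nat_ge x
    rw [this, inter_univ]
  · intro i j hij
    exact inter_subset_inter_right _ (Iic_subset_Iic.2 (by exact_mod_cast hij))

lemma mu0_cumul_le (A : Set ℝ) {c : ℝ} (hc : 0 ≤ c) (hcA : ENNReal.ofReal c ≤ mu0 A) :
    mu0 (A ∩ {z | cumul A z ≤ c}) = ENNReal.ofReal c := by
  by_cases hall : ∀ z, cumul A z ≤ c
  · have : mu0 A ≤ ENNReal.ofReal c := by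
      rw [← iSup_mu0_inter A]
      refine iSup_le fun k => ?_
      rw [← ofReal_cumul]
      exact ENNReal.ofReal_le_ofReal (hall k)
    have hu : {z | cumul A z ≤ c} = univ := eq_univ_of_forall hall
    rw [hu, inter_univ]
    exact le_antisymm this hcA
  · push Not at hall
    obtain ⟨w, hw⟩ := hall
    set Z := {z | cumul A z ≤ c} with hZ
    have hbdd : BddAbove Z := ⟨w, fun z hz => by
      by_contra h
      push Not at h
      exact absurd ((cumul_mono A h.le).trans hz) (not_le.2 hw)⟩
    have hcl : IsClosed Z := isClosed_le (cumul_continuous A) continuous_const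
    have hne : Z.Nonempty := ⟨0, by simpa [hZ, cumul_of_nonpos A le_rfl] using hc⟩
    have hmem : sSup Z ∈ Z := hcl.csSup_mem hne hbdd
    have hZeq : Z = Iic (sSup Z) := by
      ext z
      exact ⟨fun h => le_csSup hbdd h, fun h => (cumul_mono A h).trans hmem⟩
    have h0w : (0:ℝ) ≤ w := by
      by_contra h
      rw [cumul_of_nonpos A (by linarith)] at hw
      linarith
    obtain ⟨z0, -, hz0⟩ := intermediate_value_Icc h0w (cumul_continuous A).continuousOn
      (show c ∈ Icc (cumul A 0) (cumul A w) from
        ⟨by rw [cumul_of_nonpos A le_rfl]; exact hc, hw.le⟩)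
    have : cumul A (sSup Z) = c :=
      le_antisymm hmem (hz0 ▸ cumul_mono A (le_csSup hbdd (show z0 ∈ Z from hz0.le)))
    rw [hZeq, ← ofReal_cumul, this]

lemma exists_subset_mu0 {V : Set ℝ} (hV : MeasurableSet V) {x : ℝ≥0∞} (hx : x ≠ ∞)
    (hxV : x ≤ mu0 V) : ∃ B ⊆ V, MeasurableSet B ∧ mu0 B = x := by
  refine ⟨V ∩ {z | cumul V z ≤ x.toReal}, inter_subset_left,
    hV.inter (measurableSet_le (cumul_mono V).measurable measurable_const), ?_⟩
  rw [mu0_cumul_le V ENNReal.toReal_nonneg (by rwa [ENNReal.ofReal_toReal hx]),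
    ENNReal.ofReal_toReal hx]

lemma mu0_cumul_zero (A : Set ℝ) : mu0 (A ∩ {z | cumul A z ≤ 0}) = 0 := by
  rw [mu0_cumul_le A le_rfl (by simp)]; simp

lemma mu0_cumul_top (A : Set ℝ) (hA : MeasurableSet A) :
    mu0 (A ∩ {z | mu0 A ≤ ENNReal.ofReal (cumul A z)}) = 0 := by
  by_cases hfin : mu0 A = ∞
  · have : A ∩ {z | mu0 A ≤ ENNReal.ofReal (cumul A z)} = ∅ := by
      ext z
      simp [hfin]
    rw [this, measure_empty]
  · refine le_antisymm ?_ bot_le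
    refine ENNReal.le_of_forall_pos_le_add fun ε hε _ => ?_
    rw [zero_add]
    set a := (mu0 A).toReal with ha
    have haA : ENNReal.ofReal a = mu0 A := ENNReal.ofReal_toReal hfin
    rcases le_or_gt a ε with h | h
    · refine (measure_mono inter_subset_left).trans ?_
      rw [← haA]
      exact ENNReal.ofReal_le_of_le_toReal (by simpa using h)
    · have hc : ENNReal.ofReal (a - ε) ≤ mu0 A := by
        rw [← haA]; exact ENNReal.ofReal_le_ofReal (by simp)
      have h1 := mu0_cumul_le A (c := a - ε) (by linarith) hc
      have hms : MeasurableSet (A ∩ {z | cumul A z ≤ a - ε}) :=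
        hA.inter (measurableSet_le (cumul_mono A).measurable measurable_const)
      have hsub : A ∩ {z | mu0 A ≤ ENNReal.ofReal (cumul A z)} ⊆
          A \ (A ∩ {z | cumul A z ≤ a - ε}) := by
        rintro z ⟨hz, hz2⟩
        refine ⟨hz, fun hz3 => ?_⟩
        have h3 : cumul A z ≤ a - ε := hz3.2
        have h4 : a ≤ cumul A z := by
          rw [mem_ofPred_eq, ← haA] at hz2
          exact (ENNReal.ofReal_le_ofReal_iff (cumul_nonneg A z)).1 hz2
        have : (0:ℝ) < ε := hε
        linarith
      refine (measure_mono hsub).trans ?_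
      rw [measure_sdiff inter_subset_left hms.nullMeasurableSet (by rw [h1]; simp), h1, ← haA,
        ← ENNReal.ofReal_sub _ (by linarith)]
      simp

open Classical in
/-- generalized inverse of the cumulative mass function -/
def quant (B : Set ℝ) (y : ℝ) : ℝ :=
  if 0 < y ∧ ENNReal.ofReal y < mu0 B then sInf {x | y ≤ cumul B x} else 0

lemma quant_le_iff (B : Set ℝ) {y : ℝ} (hy : 0 < y) (hyB : ENNReal.ofReal y < mu0 B) (x : ℝ) :
    quant B y ≤ x ↔ y ≤ cumul B x := by
  have hq : quant B y = sInf {x | y ≤ cumul B x} := if_pos ⟨hy, hyB⟩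
  rw [hq]
  have hcl : IsClosed {x | y ≤ cumul B x} := isClosed_le continuous_const (cumul_continuous B)
  have hbdd : BddBelow {x | y ≤ cumul B x} := ⟨0, fun z hz => by
    by_contra h
    have h1 : y ≤ cumul B z := hz
    rw [cumul_of_nonpos B (by linarith)] at h1
    linarith⟩
  have hne : {x | y ≤ cumul B x}.Nonempty := by
    rw [← iSup_mu0_inter B] at hyB
    obtain ⟨k, hk⟩ := lt_iSup_iff.1 hyB
    rw [← ofReal_cumul] at hk
    exact ⟨k, ((ENNReal.ofReal_lt_ofReal_iff_of_nonneg hy.le).1 hk).le⟩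
  constructor
  · intro h
    exact le_trans (hcl.csInf_mem hne hbdd : y ≤ cumul B _) (cumul_mono B h)
  · intro h
    exact csInf_le hbdd h

lemma quant_measurable (B : Set ℝ) : Measurable (quant B) := by
  refine measurable_of_Iic fun x => ?_
  have : quant B ⁻¹' Iic x =
      ({y | 0 < y ∧ ENNReal.ofReal y < mu0 B} ∩ Iic (cumul B x)) ∪
      ({y | 0 < y ∧ ENNReal.ofReal y < mu0 B}ᶜ ∩ {_y | 0 ≤ x}) := by
    ext y
    by_cases hy : 0 < y ∧ ENNReal.ofReal y < mu0 B
    · simp only [mem_preimage, mem_Iic, quant_le_iff B hy.1 hy.2]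
      simp [hy]
    · have : quant B y = 0 := if_neg hy
      simp only [mem_preimage, mem_Iic, this]
      simp only [mem_union, mem_inter_iff, mem_compl_iff, mem_ofPred_eq, hy]
      simp
  rw [this]
  have hJ : MeasurableSet {y : ℝ | 0 < y ∧ ENNReal.ofReal y < mu0 B} :=
    (measurableSet_lt measurable_const measurable_id).inter
      (measurableSet_lt ENNReal.measurable_ofReal measurable_const)
  exact (hJ.inter measurableSet_Iic).union (hJ.compl.inter (MeasurableSet.const _))

lemma mu0_ext_Iic {μ ν : Measure ℝ} (h : ∀ x, μ (Iic x) = ν (Iic x)) (hf : ∀ x, μ (Iic x) ≠ ∞) :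
    μ = ν := by
  refine Measure.ext_of_generateFrom_of_iUnion (range Iic) (fun k : ℕ => Iic (k:ℝ)) ?_ ?_ ?_ ?_ ?_ ?_
  · rw [← borel_eq_generateFrom_Iic]; exact BorelSpace.measurable_eq
  · rintro _ ⟨a, rfl⟩ _ ⟨b, rfl⟩ _
    exact ⟨min a b, by rw [Iic_inter_Iic]⟩
  · ext x
    simpa using exists_nat_ge x
  · exact fun i => ⟨_, rfl⟩
  · exact fun i => hf _
  · rintro _ ⟨a, rfl⟩
    exact h a

/-- transport between two sets of equal measure -/
lemma exists_transport {A B : Set ℝ} (hA : MeasurableSet A) (h : mu0 A = mu0 B) :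
    ∃ T : ℝ → ℝ, Measurable T ∧ Measure.map T (mu0.restrict A) = mu0.restrict B := by
  have hTm : Measurable (fun z => quant B (cumul A z)) :=
    (quant_measurable B).comp (cumul_mono A).measurable
  refine ⟨fun z => quant B (cumul A z), hTm, ?_⟩
  symm
  refine mu0_ext_Iic (fun x => ?_) (fun x => ?_)
  · rw [Measure.map_apply hTm measurableSet_Iic, Measure.restrict_apply measurableSet_Iic,
      Measure.restrict_apply (hTm measurableSet_Iic), inter_comm, ← ofReal_cumul,
      ← mu0_cumul_le A (cumul_nonneg B x)
        (by rw [ofReal_cumul, h]; exact measure_mono inter_subset_left)]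
    have h1 : ∀ᵐ z ∂mu0, z ∉ A ∩ {z | cumul A z ≤ 0} := measure_eq_zero_iff_ae_notMem.1 (mu0_cumul_zero A)
    have h2 := measure_eq_zero_iff_ae_notMem.1 (mu0_cumul_top A hA)
    refine measure_congr ?_
    filter_upwards [h1, h2] with z hz1 hz2
    apply propext
    change z ∈ A ∩ {z | cumul A z ≤ cumul B x} ↔ z ∈ (fun z => quant B (cumul A z)) ⁻¹' Iic x ∩ A
    by_cases hzA : z ∈ A
    · have e1 : 0 < cumul A z := by
        by_contra hc
        exact hz1 ⟨hzA, not_lt.1 hc⟩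
      have e2 : ENNReal.ofReal (cumul A z) < mu0 B := by
        rw [← h]
        by_contra hc
        exact hz2 ⟨hzA, not_lt.1 hc⟩
      simp [hzA, quant_le_iff B e1 e2]
    · simp [hzA]
  · rw [Measure.restrict_apply measurableSet_Iic, inter_comm]
    exact mu0_inter_Iic_ne B x

lemma exists_swap_map {D A B : Set ℝ} (hD : MeasurableSet D) (hA : MeasurableSet A)
    (hB : MeasurableSet B) (hDA : Disjoint D A) (hDB : Disjoint D B) (hDf : mu0 D ≠ ∞)
    (hAf : mu0 A ≠ ∞) (hAB : mu0 A = mu0 B) :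
    ∃ T : ℝ → ℝ, MeasurePreserving T mu0 mu0 ∧ (∀ x ∈ D, T x = x) ∧
      Measure.map T (mu0.restrict A) = mu0.restrict B := by
  classical
  have hinf : ∀ X : Set ℝ, MeasurableSet X → mu0 X ≠ ∞ → mu0 (D ∪ X)ᶜ = ∞ := by
    intro X hX hXf
    rw [measure_compl (hD.union hX), mu0_univ, ENNReal.top_sub]
    · exact ((measure_union_le D X).trans_lt (ENNReal.add_lt_top.2 ⟨hDf.lt_top, hXf.lt_top⟩)).ne
    · exact ((measure_union_le D X).trans_lt (ENNReal.add_lt_top.2 ⟨hDf.lt_top, hXf.lt_top⟩)).ne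
  obtain ⟨T1, hT1, hT1'⟩ := exists_transport hA hAB
  obtain ⟨T2, hT2, hT2'⟩ := exists_transport (hD.union hA).compl
    ((hinf A hA hAf).trans (hinf B hB (hAB ▸ hAf)).symm)
  set T : ℝ → ℝ := fun x => if x ∈ D then x else if x ∈ A then T1 x else T2 x with hT
  have hTm : Measurable T := Measurable.ite hD measurable_id (Measurable.ite hA hT1 hT2)
  have hmD : Measure.map T (mu0.restrict D) = mu0.restrict D := by
    have : T =ᵐ[mu0.restrict D] id := by
      filter_upwards [ae_restrict_mem hD] with x hx
      simp [hT, hx]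
    rw [Measure.map_congr this, Measure.map_id]
  have hmA : Measure.map T (mu0.restrict A) = mu0.restrict B := by
    have : T =ᵐ[mu0.restrict A] T1 := by
      filter_upwards [ae_restrict_mem hA] with x hx
      have : x ∉ D := fun h => disjoint_left.1 hDA h hx
      simp [hT, hx, this]
    rw [Measure.map_congr this, hT1']
  have hmC : Measure.map T (mu0.restrict (D ∪ A)ᶜ) = mu0.restrict (D ∪ B)ᶜ := by
    have : T =ᵐ[mu0.restrict (D ∪ A)ᶜ] T2 := by
      filter_upwards [ae_restrict_mem (hD.union hA).compl] with x hx
      have h1 : x ∉ D := fun h => hx (Or.inl h)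
      have h2 : x ∉ A := fun h => hx (Or.inr h)
      simp [hT, h1, h2]
    rw [Measure.map_congr this, hT2']
  have hdec : ∀ X : Set ℝ, MeasurableSet X → Disjoint D X →
      mu0 = mu0.restrict D + mu0.restrict X + mu0.restrict (D ∪ X)ᶜ := by
    intro X hX hdis
    rw [← Measure.restrict_union hdis hX, Measure.restrict_add_restrict_compl (hD.union hX)]
  refine ⟨T, ⟨hTm, ?_⟩, fun x hx => by simp [hT, hx], hmA⟩
  conv_lhs => rw [hdec A hA hDA]
  rw [Measure.map_add _ _ hTm, Measure.map_add _ _ hTm, hmD, hmA, hmC]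
  exact (hdec B hB hDB).symm

/-! ### Rearrangements and distribution functions -/

lemma distr_le_of_rearr_le {f : ℝ → ℝ≥0∞} {l : ℝ≥0∞} {t : ℝ} (h : rearr f t ≤ l) :
    mu0 {x | l < f x} ≤ ENNReal.ofReal t := by
  rcases eq_or_ne l ∞ with rfl | hl
  · simp
  · have key : ∀ l', l < l' → mu0 {x | l' < f x} ≤ ENNReal.ofReal t := by
      intro l' hl'
      obtain ⟨l'', h1, h2⟩ := sInf_lt_iff.1 (lt_of_le_of_lt h hl')
      refine (measure_mono fun x hx => ?_).trans h1
      exact lt_trans h2 hx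
    obtain ⟨u, hu, hu1, hu2⟩ := exists_seq_strictAnti_tendsto' (lt_top_iff_ne_top.2 hl)
    have hun : {x | l < f x} = ⋃ k, {x | u k < f x} := by
      ext x
      simp only [mem_ofPred_eq, mem_iUnion]
      constructor
      · intro hx
        exact ((hu2.eventually (gt_mem_nhds hx))).exists
      · rintro ⟨k, hk⟩
        exact (hu1 k).1.trans hk
    rw [hun, Monotone.measure_iUnion]
    · exact iSup_le fun k => key _ (hu1 k).1
    · intro i j hij x hx
      exact lt_of_le_of_lt (hu.antitone hij) hx

lemma distr_eq_of_rearr_eq {f g : ℝ → ℝ≥0∞} (h : rearr f = rearr g) (l : ℝ≥0∞) :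
    mu0 {x | l < f x} = mu0 {x | l < g x} := by
  have key : ∀ f g : ℝ → ℝ≥0∞, rearr f = rearr g → mu0 {x | l < f x} ≤ mu0 {x | l < g x} := by
    intro f g h
    by_cases hg : mu0 {x | l < g x} = ∞
    · rw [hg]; exact le_top
    · have := distr_le_of_rearr_le (f := f) (l := l) (t := (mu0 {x | l < g x}).toReal) (by
        rw [h]
        refine sInf_le ?_
        simp [ENNReal.ofReal_toReal hg])
      rwa [ENNReal.ofReal_toReal hg] at this
  exact le_antisymm (key f g h) (key g f h.symm)

lemma rearr_comp {f : ℝ → ℝ≥0∞} (hf : Measurable f) {T : ℝ → ℝ}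
    (hT : MeasurePreserving T mu0 mu0) : rearr (fun x => f (T x)) = rearr f := by
  funext t
  unfold rearr rearrangement
  congr 1
  ext l
  have : mu0 {x | l < f (T x)} = mu0 {x | l < f x} :=
    hT.measure_preimage (measurableSet_lt measurable_const hf).nullMeasurableSet
  simp only [mem_ofPred_eq, this]

lemma exists_rearranging {u h : ℝ → ℝ≥0∞} (hu : Measurable u)
    (hd : ∀ l, mu0 {x | l < h x} ≤ mu0 {x | l < u x})
    (s : SimpleFunc ℝ ℝ≥0∞) (hs : ∀ x, s x ≤ h x) (hst : ∀ x, s x < ∞)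
    (N : ℝ) {r : ℝ≥0∞} (hr0 : r ≠ 0) (hr : r < 1) (F : Finset ℝ≥0∞) :
    ∃ T : ℝ → ℝ, MeasurePreserving T mu0 mu0 ∧
      ∀ᵐ x ∂mu0, x ≤ N → s x ∈ F → r * s x ≤ u (T x) := by
  have hrt : r ≠ ∞ := (hr.trans ENNReal.one_lt_top).ne
  induction F using Finset.induction_on_min with
  | empty => exact ⟨id, MeasurePreserving.id _, by simp⟩
  | insert a F haF ih =>
    obtain ⟨T, hT, hTae⟩ := ih
    rcases eq_or_ne a 0 with rfl | ha0
    · refine ⟨T, hT, ?_⟩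
      filter_upwards [hTae] with x hx hxN hxF
      rcases Finset.mem_insert.1 hxF with h0 | h0
      · simp [h0]
      · exact hx hxN h0
    rcases eq_or_ne a ∞ with rfl | hat
    · refine ⟨T, hT, ?_⟩
      filter_upwards [hTae] with x hx hxN hxF
      rcases Finset.mem_insert.1 hxF with h0 | h0
      · exact absurd h0 (hst x).ne
      · exact hx hxN h0
    have hra : r * a < a := by
      calc r * a < 1 * a := by
            rwa [ENNReal.mul_lt_mul_iff_left ha0 hat]
        _ = a := one_mul a
    set D : Set ℝ := Iic N ∩ s ⁻¹' (F : Set ℝ≥0∞) with hD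
    set A : Set ℝ := Iic N ∩ s ⁻¹' {a} with hA
    set V : Set ℝ := T ⁻¹' {x | r * a < u x} with hV
    have hDm : MeasurableSet D := measurableSet_Iic.inter (s.measurableSet_preimage _)
    have hAm : MeasurableSet A := measurableSet_Iic.inter (s.measurableSet_preimage _)
    have hUm : MeasurableSet {x | r * a < u x} := measurableSet_lt measurable_const hu
    have hVm : MeasurableSet V := hT.measurable hUm
    have hDA : Disjoint D A := by
      rw [disjoint_left]
      rintro x ⟨-, h1⟩ ⟨-, h2⟩
      have h1' : s x ∈ F := h1
      have h2' : s x = a := h2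
      rw [h2'] at h1'
      exact lt_irrefl _ (haF a h1')
    have hfinN : mu0 (Iic N) ≠ ∞ := by rw [mu0_Iic]; simp
    have hDf : mu0 D ≠ ∞ := measure_ne_top_of_subset inter_subset_left hfinN
    have hAf : mu0 A ≠ ∞ := measure_ne_top_of_subset inter_subset_left hfinN
    have h1 : mu0 A + mu0 D ≤ mu0 V := by
      rw [add_comm, ← measure_union hDA hAm, hV, hT.measure_preimage hUm.nullMeasurableSet]
      refine le_trans (measure_mono ?_) (hd (r * a))
      rintro x (⟨-, hx⟩ | ⟨-, hx⟩)
      · have hx' : s x ∈ F := hx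
        exact (hra.trans (haF _ hx')).trans_le (hs x)
      · have hx' : s x = a := hx
        exact (hx' ▸ hra : r * a < s x).trans_le (hs x)
    have h2 : mu0 A ≤ mu0 (V \ D) := by
      have h3 : mu0 V ≤ mu0 (V \ D) + mu0 D := by
        refine (measure_mono ?_).trans (measure_union_le _ _)
        rw [sdiff_union_self]
        exact subset_union_left
      exact (ENNReal.add_le_add_iff_right hDf).1 (h1.trans h3)
    obtain ⟨B, hBV, hBm, hBA⟩ := exists_subset_mu0 (hVm.diff hDm) hAf h2
    have hDB : Disjoint D B := disjoint_left.2 fun x hx hxB => (hBV hxB).2 hx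
    obtain ⟨S, hS, hSD, hSA⟩ := exists_swap_map hDm hAm hBm hDA hDB hDf hAf hBA.symm
    refine ⟨T ∘ S, hT.comp hS, ?_⟩
    have h4 : ∀ᵐ x ∂mu0, x ∈ A → S x ∈ B := by
      rw [← ae_restrict_iff' hAm]
      have : ∀ᵐ y ∂(Measure.map S (mu0.restrict A)), y ∈ B := by
        rw [hSA]; exact ae_restrict_mem hBm
      exact ae_of_ae_map hS.measurable.aemeasurable this
    filter_upwards [hTae, h4] with x hx hx4 hxN hxF
    rcases Finset.mem_insert.1 hxF with h0 | h0
    · have := (hBV (hx4 ⟨hxN, h0⟩)).1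
      rw [h0]
      exact (this : r * a < u (T (S x))).le
    · rw [Function.comp_apply, hSD x ⟨hxN, h0⟩]
      exact hx hxN h0

/-! ### The Hardy operator -/

lemma hardyOp_antitone (m n : ℕ) (f : ℝ → ℝ≥0∞) : Antitone (hardyOp m n f) := fun _ _ h =>
  lintegral_mono_set (Ioi_subset_Ioi h)

lemma hardyOp_measurable (m n : ℕ) (f : ℝ → ℝ≥0∞) : Measurable (hardyOp m n f) :=
  (hardyOp_antitone m n f).measurable

lemma weight_measurable (m n : ℕ) :
    Measurable (fun s : ℝ => ENNReal.ofReal (s ^ ((m : ℝ)/(n : ℝ) - 1))) := by fun_prop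

lemma ae_mu0_pos : ∀ᵐ t ∂mu0, 0 < t := ae_restrict_mem measurableSet_Ioi

lemma hardyOp_mono_ae (m n : ℕ) {f g : ℝ → ℝ≥0∞} (h : ∀ᵐ t ∂mu0, f t ≤ g t) :
    ∀ᵐ t ∂mu0, hardyOp m n f t ≤ hardyOp m n g t := by
  filter_upwards [ae_mu0_pos] with t ht
  refine lintegral_mono_ae ?_
  have : ∀ᵐ s ∂(volume.restrict (Ioi t)), f s ≤ g s :=
    ae_restrict_of_ae_restrict_of_subset (Ioi_subset_Ioi ht.le) h
  filter_upwards [this] with s hs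
  gcongr

lemma hardyOp_add (m n : ℕ) {f g : ℝ → ℝ≥0∞} (hf : Measurable f) :
    hardyOp m n (f + g) = hardyOp m n f + hardyOp m n g := by
  funext t
  simp only [hardyOp, Pi.add_apply, add_mul]
  exact lintegral_add_left (hf.mul (weight_measurable m n)) _

lemma hardyOp_smul (m n : ℕ) (c : ℝ≥0) {f : ℝ → ℝ≥0∞} (hf : Measurable f) :
    hardyOp m n (fun t => (c : ℝ≥0∞) * f t) = fun t => (c : ℝ≥0∞) * hardyOp m n f t := by
  funext t
  simp only [hardyOp, mul_assoc]
  exact lintegral_const_mul _ (hf.mul (weight_measurable m n))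

lemma hardyOp_iSup (m n : ℕ) {F : ℕ → ℝ → ℝ≥0∞} {f : ℝ → ℝ≥0∞} (hF : ∀ j, Measurable (F j))
    (hmono : ∀ j t, F j t ≤ F (j + 1) t) (hsup : ∀ t, (⨆ j, F j t) = f t) (t : ℝ) :
    (⨆ j, hardyOp m n (F j) t) = hardyOp m n f t := by
  simp only [hardyOp, ← hsup, ENNReal.iSup_mul]
  symm
  refine lintegral_iSup (fun j => (hF j).mul (weight_measurable m n)) ?_
  refine monotone_nat_of_le_succ fun j s => ?_
  have := hmono j s
  simp only
  gcongr

lemma norm_hardy_mono (m n : ℕ) {ρ : (ℝ → ℝ≥0∞) → ℝ≥0∞} (hY : IsRINorm ρ) {f g : ℝ → ℝ≥0∞}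
    (h : ∀ᵐ t ∂mu0, f t ≤ g t) : ρ (hardyOp m n f) ≤ ρ (hardyOp m n g) :=
  hY.mono _ _ (hardyOp_measurable m n f) (hardyOp_measurable m n g) (hardyOp_mono_ae m n h)

lemma norm_hardy_iSup (m n : ℕ) {ρ : (ℝ → ℝ≥0∞) → ℝ≥0∞} (hY : IsRINorm ρ)
    {F : ℕ → ℝ → ℝ≥0∞} {f : ℝ → ℝ≥0∞} (hF : ∀ j, Measurable (F j))
    (hmono : ∀ j t, F j t ≤ F (j + 1) t) (hsup : ∀ t, (⨆ j, F j t) = f t) :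
    (⨆ j, ρ (hardyOp m n (F j))) = ρ (hardyOp m n f) := by
  refine hY.fatou _ _ (fun j => hardyOp_measurable m n _) (hardyOp_measurable m n _) ?_
    (hardyOp_iSup m n hF hmono hsup)
  intro j t
  refine lintegral_mono fun s => ?_
  have := hmono j s
  simp only
  gcongr

/-- the supremum over measure preserving transformations -/
def tauT (m n : ℕ) (ρ : (ℝ → ℝ≥0∞) → ℝ≥0∞) (f : ℝ → ℝ≥0∞) : ℝ≥0∞ :=
  ⨆ (T : ℝ → ℝ) (_ : MeasurePreserving T mu0 mu0), ρ (hardyOp m n (fun x => f (T x)))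

lemma le_tauT (m n : ℕ) (ρ : (ℝ → ℝ≥0∞) → ℝ≥0∞) (f : ℝ → ℝ≥0∞) {T : ℝ → ℝ}
    (hT : MeasurePreserving T mu0 mu0) : ρ (hardyOp m n (fun x => f (T x))) ≤ tauT m n ρ f :=
  le_iSup₂_of_le T hT le_rfl

lemma norm_hardy_le_tauT (m n : ℕ) {ρ : (ℝ → ℝ≥0∞) → ℝ≥0∞} (hY : IsRINorm ρ) {u h : ℝ → ℝ≥0∞}
    (hu : Measurable u) (hh : Measurable h) (hd : rearr h = rearr u) :
    ρ (hardyOp m n h) ≤ tauT m n ρ u := by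
  set F : ℕ → ℝ → ℝ≥0∞ := fun k => (Iic (k:ℝ)).indicator (SimpleFunc.eapprox h k) with hF
  have hFm : ∀ k, Measurable (F k) := fun k =>
    (SimpleFunc.measurable _).indicator measurableSet_Iic
  have hsub : ∀ i j : ℕ, i ≤ j → Iic (i:ℝ) ⊆ Iic (j:ℝ) := fun i j hij =>
    Iic_subset_Iic.2 (by exact_mod_cast hij)
  have hmono : Monotone F := by
    intro i j hij x
    exact (indicator_le_indicator_of_subset (hsub i j hij) (fun _ => bot_le) x).trans
      (indicator_le_indicator (SimpleFunc.monotone_eapprox h hij x))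
  have hsup : ∀ t, (⨆ j, F j t) = h t := by
    intro t
    refine le_antisymm (iSup_le fun j => ?_) ?_
    · refine (indicator_le_self _ _ t).trans ?_
      rw [← SimpleFunc.iSup_eapprox_apply hh t]
      exact le_iSup (fun k => SimpleFunc.eapprox h k t) j
    · rw [← SimpleFunc.iSup_eapprox_apply hh t]
      refine iSup_le fun k => ?_
      obtain ⟨N, hN⟩ := exists_nat_ge t
      refine le_iSup_of_le (max k N) ?_
      have hmem : t ∈ Iic ((max k N : ℕ) : ℝ) :=
        hsub N _ (le_max_right _ _) (show t ∈ Iic (N:ℝ) from hN)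
      simp only [hF, indicator_of_mem hmem]
      exact SimpleFunc.monotone_eapprox h (le_max_left _ _) t
  rw [← norm_hardy_iSup m n hY hFm (fun j => hmono (Nat.le_succ j)) hsup]
  refine iSup_le fun k => ENNReal.le_of_forall_lt_one_mul_le fun r hr => ?_
  rcases eq_or_ne r 0 with rfl | hr0
  · simp
  obtain ⟨T, hT, hTae⟩ := exists_rearranging hu (fun l => (distr_eq_of_rearr_eq hd l).le)
    (SimpleFunc.eapprox h k) (fun x => by
      rw [← SimpleFunc.iSup_eapprox_apply hh x]
      exact le_iSup (fun k => SimpleFunc.eapprox h k x) k)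
    (SimpleFunc.eapprox_lt_top h k) (k:ℝ) hr0 hr (SimpleFunc.eapprox h k).range
  lift r to ℝ≥0 using (hr.trans ENNReal.one_lt_top).ne
  rw [← hY.smul r _ (hardyOp_measurable m n _), ← hardyOp_smul m n r (hFm k)]
  refine (norm_hardy_mono m n hY ?_).trans (le_tauT m n ρ u hT)
  filter_upwards [hTae] with x hx
  by_cases hxk : x ∈ Iic (k:ℝ)
  · simp only [hF, indicator_of_mem hxk]
    exact hx hxk (SimpleFunc.mem_range_self _ x)
  · simp [hF, indicator_of_notMem hxk]

lemma tauFun_eq (m n : ℕ) {ρ : (ℝ → ℝ≥0∞) → ℝ≥0∞} (hY : IsRINorm ρ) {f : ℝ → ℝ≥0∞}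
    (hf : Measurable f) : tauFun m n ρ f = tauT m n ρ f := by
  refine le_antisymm ?_ ?_
  · exact iSup_le fun h => iSup₂_le fun hh hd => norm_hardy_le_tauT m n hY hf hh hd
  · refine iSup₂_le fun T hT => ?_
    exact le_iSup_of_le (fun x => f (T x))
      (le_iSup₂_of_le (hf.comp hT.measurable) (rearr_comp hf hT) le_rfl)

/-! ### Fundamental function estimates -/

lemma norm_ind_pos {ρ : (ℝ → ℝ≥0∞) → ℝ≥0∞} (hY : IsRINorm ρ) {r : ℝ} (hr : 0 < r) :
    ρ ((Ioo (0:ℝ) r).indicator 1) ≠ 0 := by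
  intro h
  have h1 := (hY.eq_zero_iff _ (measurable_one.indicator measurableSet_Ioo)).1 h
  have h2 : mu0 (Ioo (0:ℝ) r) = 0 := by
    refine measure_eq_zero_iff_ae_notMem.2 ?_
    filter_upwards [h1] with x hx hx2
    simp [indicator_of_mem hx2] at hx
  unfold mu0 at h2
  rw [Measure.restrict_apply measurableSet_Ioo, inter_eq_left.2 Ioo_subset_Ioi_self,
    Real.volume_Ioo, ENNReal.ofReal_eq_zero] at h2
  linarith

lemma norm_ind_ne_top {ρ : (ℝ → ℝ≥0∞) → ℝ≥0∞} (hY : IsRINorm ρ) (r : ℝ) :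
    ρ ((Ioo (0:ℝ) r).indicator 1) ≠ ∞ := by
  refine (hY.indicator_lt_top _ measurableSet_Ioo ?_).ne
  refine (Measure.restrict_apply_le _ _).trans_lt ?_
  simp

lemma mul_norm_ind_le {ρ : (ℝ → ℝ≥0∞) → ℝ≥0∞} (hY : IsRINorm ρ) {r : ℝ} {c : ℝ≥0∞}
    {g : ℝ → ℝ≥0∞} (hg : Measurable g) (h : ∀ t ∈ Ioo (0:ℝ) r, c ≤ g t) :
    c * ρ ((Ioo (0:ℝ) r).indicator 1) ≤ ρ g := by
  refine ENNReal.mul_le_of_forall_lt fun a ha b hb => ?_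
  refine le_trans (mul_le_mul_right hb.le a) ?_
  lift a to ℝ≥0 using (ha.trans_le le_top).ne
  rw [← hY.smul a _ (measurable_one.indicator measurableSet_Ioo)]
  refine hY.mono _ _ ((measurable_one.indicator measurableSet_Ioo).const_mul _) hg ?_
  refine Eventually.of_forall fun t => ?_
  by_cases ht : t ∈ Ioo (0:ℝ) r
  · simp only [indicator_of_mem ht, Pi.one_apply, mul_one]
    exact ha.le.trans (h t ht)
  · simp [indicator_of_notMem ht]

lemma norm_le_mul_ind {ρ : (ℝ → ℝ≥0∞) → ℝ≥0∞} (hY : IsRINorm ρ) {r : ℝ} {c : ℝ≥0∞}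
    (hc : c ≠ ∞) {g : ℝ → ℝ≥0∞} (hg : Measurable g) (h : ∀ t, 0 < t → t < r → g t ≤ c)
    (h' : ∀ t, 0 < t → r ≤ t → g t = 0) :
    ρ g ≤ c * ρ ((Ioo (0:ℝ) r).indicator 1) := by
  lift c to ℝ≥0 using hc
  rw [← hY.smul c _ (measurable_one.indicator measurableSet_Ioo)]
  refine hY.mono _ _ hg ((measurable_one.indicator measurableSet_Ioo).const_mul _) ?_
  filter_upwards [ae_mu0_pos] with t ht
  rcases lt_or_ge t r with htr | htr
  · have : t ∈ Ioo (0:ℝ) r := ⟨ht, htr⟩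
    simp only [indicator_of_mem this, Pi.one_apply, mul_one]
    exact h t ht htr
  · rw [h' t ht htr]; exact bot_le

lemma weight_anti {p s t : ℝ} (hp : p < 1) (hs : 0 < s) (hst : s ≤ t) :
    ENNReal.ofReal (t ^ (p - 1)) ≤ ENNReal.ofReal (s ^ (p - 1)) :=
  ENNReal.ofReal_le_ofReal (Real.rpow_le_rpow_of_nonpos hs hst (by linarith))

lemma weight_mul {p t : ℝ} (ht : 0 < t) :
    ENNReal.ofReal (t ^ (p - 1)) * ENNReal.ofReal (t ^ (1 - p)) = 1 := by
  rw [← ENNReal.ofReal_mul (by positivity), ← Real.rpow_add ht]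
  simp

lemma pow_double {p t : ℝ} (hp0 : 0 ≤ p) (hp : p < 1) (ht : 1 ≤ t) :
    ENNReal.ofReal ((t + 1) ^ (1 - p)) ≤ 2 * ENNReal.ofReal (t ^ (1 - p)) := by
  have : (t + 1) ^ (1 - p) ≤ 2 * t ^ (1 - p) := by
    calc (t + 1) ^ (1 - p) ≤ (2 * t) ^ (1 - p) :=
          Real.rpow_le_rpow (by linarith) (by linarith) (by linarith)
      _ = 2 ^ (1 - p) * t ^ (1 - p) := Real.mul_rpow (by norm_num) (by linarith)
      _ ≤ 2 ^ (1:ℝ) * t ^ (1 - p) := by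
          gcongr
          · norm_num
          · linarith
      _ = 2 * t ^ (1 - p) := by rw [Real.rpow_one]
  refine (ENNReal.ofReal_le_ofReal this).trans ?_
  rw [ENNReal.ofReal_mul (by norm_num)]
  simp

lemma exponent_bounds {m n : ℕ} (hm : 1 ≤ m) (hmn : m < n) :
    0 < (m : ℝ)/(n : ℝ) ∧ (m : ℝ)/(n : ℝ) < 1 := by
  have h1 : (0:ℝ) < m := by exact_mod_cast hm
  have h2 : (m:ℝ) < n := by exact_mod_cast hmn
  exact ⟨div_pos h1 (h1.trans h2), (div_lt_one (h1.trans h2)).2 h2⟩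

lemma mu0_apply_sub {A : Set ℝ} (hA : A ⊆ Ioi 0) : mu0.restrict A = volume.restrict A := by
  unfold mu0
  rw [Measure.restrict_restrict_of_subset hA]

lemma mu0_Ioc {a b : ℝ} (ha : 0 ≤ a) : mu0 (Ioc a b) = ENNReal.ofReal (b - a) := by
  have : Ioc a b ⊆ Ioi 0 := fun x hx => lt_of_le_of_lt ha hx.1
  unfold mu0
  rw [Measure.restrict_apply measurableSet_Ioc, inter_eq_left.2 this, Real.volume_Ioc]

/-- lower bound for the Hardy operator -/
lemma hardyOp_ge {m n : ℕ} (hm : 1 ≤ m) (hmn : m < n) (g : ℝ → ℝ≥0∞) {a b t : ℝ} (ha : 0 < a)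
    (hta : t ≤ a) :
    ENNReal.ofReal (b ^ ((m : ℝ)/(n : ℝ) - 1)) * ∫⁻ s in Ioc a b, g s ∂mu0 ≤ hardyOp m n g t := by
  have hsub : Ioc a b ⊆ Ioi 0 := fun x hx => lt_trans ha hx.1
  rw [mu0_apply_sub hsub, mul_comm, ← lintegral_mul_const' _ _ ENNReal.ofReal_ne_top]
  unfold hardyOp
  refine le_trans (setLIntegral_mono_ae' measurableSet_Ioc ?_)
    (lintegral_mono_set (fun x (hx : x ∈ Ioc a b) => (lt_of_le_of_lt hta hx.1 : t < x)))
  refine Eventually.of_forall fun s hs => ?_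
  exact mul_le_mul_right (weight_anti (exponent_bounds hm hmn).2 (ha.trans hs.1) hs.2) _

lemma tauT_local {m n : ℕ} (hm : 1 ≤ m) (hmn : m < n) {ρ : (ℝ → ℝ≥0∞) → ℝ≥0∞} (hY : IsRINorm ρ)
    {E : Set ℝ} (hE : MeasurableSet E) (hEf : mu0 E < ∞) : ∃ C : ℝ≥0∞, 0 < C ∧ C < ∞ ∧
    ∀ f : ℝ → ℝ≥0∞, Measurable f → (∫⁻ t in E, f t ∂mu0) ≤ C * tauT m n ρ f := by
  set a := (mu0 E).toReal with ha
  have ha0 : 0 ≤ a := ENNReal.toReal_nonneg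
  have haE : ENNReal.ofReal a = mu0 E := ENNReal.ofReal_toReal hEf.ne
  set p := (m : ℝ)/(n : ℝ) with hp
  set w := ENNReal.ofReal ((1 + a) ^ (p - 1)) with hw
  have hw0 : w ≠ 0 := by
    rw [hw, Ne, ENNReal.ofReal_eq_zero, not_le]; positivity
  set φ := ρ ((Ioo (0:ℝ) 1).indicator 1) with hφ
  have hφ0 : φ ≠ 0 := norm_ind_pos hY one_pos
  have hφt : φ ≠ ∞ := norm_ind_ne_top hY 1
  have hwφ0 : w * φ ≠ 0 := mul_ne_zero hw0 hφ0
  have hwφt : w * φ ≠ ∞ := ENNReal.mul_ne_top ENNReal.ofReal_ne_top hφt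
  refine ⟨(w * φ)⁻¹, ENNReal.inv_pos.2 hwφt, ENNReal.inv_lt_top.2 (pos_iff_ne_zero.2 hwφ0), ?_⟩
  intro f hf
  have hmA : mu0 (Ioc 1 (1 + a)) = mu0 E := by
    rw [mu0_Ioc zero_le_one, ← haE]; congr 1; ring
  obtain ⟨T, hT, -, hTA⟩ := exists_swap_map (D := ∅) MeasurableSet.empty
    (measurableSet_Ioc (a := (1:ℝ)) (b := 1 + a)) hE (disjoint_bot_left) (disjoint_bot_left)
    (by simp) (hmA ▸ hEf.ne) hmA
  have h1 : ∫⁻ t in E, f t ∂mu0 = ∫⁻ s in Ioc 1 (1 + a), f (T s) ∂mu0 := by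
    rw [← hTA, lintegral_map hf hT.measurable]
  have h2 : (w * ∫⁻ t in E, f t ∂mu0) * φ ≤ tauT m n ρ f := by
    refine le_trans (mul_norm_ind_le hY (hardyOp_measurable m n _) fun t ht => ?_)
      (le_tauT m n ρ f hT)
    rw [h1]
    exact hardyOp_ge hm hmn _ one_pos ht.2.le
  rw [mul_right_comm] at h2
  calc ∫⁻ t in E, f t ∂mu0 = (w * φ)⁻¹ * (w * φ * ∫⁻ t in E, f t ∂mu0) := by
        rw [← mul_assoc, ENNReal.inv_mul_cancel hwφ0 hwφt, one_mul]
    _ ≤ _ := by gcongr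

lemma weight_integral_ne_top {p : ℝ} (hp : 0 < p) :
    ∫⁻ s in Ioc (0:ℝ) 1, ENNReal.ofReal (s ^ (p - 1)) ≠ ∞ := by
  have h : IntegrableOn (fun s : ℝ => s ^ (p - 1)) (Ioc 0 1) :=
    (intervalIntegrable_iff_integrableOn_Ioc_of_le zero_le_one).1
      (intervalIntegral.intervalIntegrable_rpow' (by linarith))
  exact (h.lintegral_lt_top).ne

lemma norm_hardy_piece {m n : ℕ} (hm : 1 ≤ m) (hmn : m < n) {ρ : (ℝ → ℝ≥0∞) → ℝ≥0∞}
    (hY : IsRINorm ρ) {K : ℝ≥0∞}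
    (hK : ∀ t : ℝ, 1 ≤ t → ρ ((Ioo (0:ℝ) t).indicator 1) ≤
      K * ENNReal.ofReal (t ^ (1 - (m : ℝ)/(n : ℝ))))
    {G : Set ℝ} (hG : MeasurableSet G) (hGf : mu0 G ≠ ∞) {j : ℝ} (hj : 1 ≤ j)
    (hGj : G ⊆ Ioc j (j + 1)) :
    ρ (hardyOp m n (G.indicator 1)) ≤ 2 * K * mu0 G := by
  obtain ⟨hp0, hp1⟩ := exponent_bounds hm hmn
  have h1 : ρ (hardyOp m n (G.indicator 1)) ≤ (ENNReal.ofReal (j ^ ((m : ℝ)/(n : ℝ) - 1)) * mu0 G) *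
      ρ ((Ioo (0:ℝ) (j + 1)).indicator 1) := by
    refine norm_le_mul_ind hY (ENNReal.mul_ne_top ENNReal.ofReal_ne_top hGf)
      (hardyOp_measurable m n _) ?_ ?_
    · intro t ht0 ht
      calc hardyOp m n (G.indicator 1) t
          ≤ ∫⁻ s in Ioi (0:ℝ), G.indicator 1 s * ENNReal.ofReal (s ^ ((m : ℝ)/(n : ℝ) - 1)) :=
            lintegral_mono_set (Ioi_subset_Ioi ht0.le)
        _ ≤ ∫⁻ s in Ioi (0:ℝ), G.indicator (fun _ => ENNReal.ofReal (j ^ ((m : ℝ)/(n : ℝ) - 1))) s := by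
            refine lintegral_mono fun s => ?_
            by_cases hs : s ∈ G
            · simp only [indicator_of_mem hs, Pi.one_apply, one_mul]
              exact weight_anti hp1 (by linarith) (hGj hs).1.le
            · simp [indicator_of_notMem hs]
        _ = _ := by rw [lintegral_indicator_const hG]; rfl
    · intro t ht0 ht
      unfold hardyOp
      rw [setLIntegral_congr_fun (g := fun _ => 0) measurableSet_Ioi]
      · simp
      · intro s hs
        have : s ∉ G := fun h => absurd (hGj h).2 (not_le.2 (lt_of_le_of_lt ht hs))
        simp [indicator_of_notMem this]
  refine h1.trans ?_
  calc _ ≤ (ENNReal.ofReal (j ^ ((m : ℝ)/(n : ℝ) - 1)) * mu0 G) *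
        (K * (2 * ENNReal.ofReal (j ^ (1 - (m : ℝ)/(n : ℝ))))) := by
        gcongr
        refine (hK (j + 1) (by linarith)).trans ?_
        gcongr
        exact pow_double hp0.le hp1 hj
    _ = 2 * K * mu0 G * (ENNReal.ofReal (j ^ ((m : ℝ)/(n : ℝ) - 1)) *
        ENNReal.ofReal (j ^ (1 - (m : ℝ)/(n : ℝ)))) := by ring
    _ = _ := by rw [weight_mul (by linarith), mul_one]

lemma norm_hardy_near_zero {m n : ℕ} (hm : 1 ≤ m) (hmn : m < n) {ρ : (ℝ → ℝ≥0∞) → ℝ≥0∞}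
    (hY : IsRINorm ρ) {G : Set ℝ} (hGj : G ⊆ Iic 1) :
    ρ (hardyOp m n (G.indicator 1)) ≤
      (∫⁻ s in Ioc (0:ℝ) 1, ENNReal.ofReal (s ^ ((m : ℝ)/(n : ℝ) - 1))) *
        ρ ((Ioo (0:ℝ) 1).indicator 1) := by
  obtain ⟨hp0, hp1⟩ := exponent_bounds hm hmn
  refine norm_le_mul_ind hY (weight_integral_ne_top hp0) (hardyOp_measurable m n _) ?_ ?_
  · intro t ht0 ht
    unfold hardyOp
    rw [← lintegral_indicator measurableSet_Ioi, ← lintegral_indicator measurableSet_Ioc]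
    refine lintegral_mono fun s => ?_
    by_cases hs : s ∈ Ioi t
    · by_cases hsG : s ∈ G
      · have : s ∈ Ioc (0:ℝ) 1 := ⟨ht0.trans hs, hGj hsG⟩
        simp [hs, hsG, indicator_of_mem this]
      · simp [hsG, hs]
    · simp [indicator_of_notMem hs]
  · intro t ht0 ht
    unfold hardyOp
    rw [setLIntegral_congr_fun (g := fun _ => 0) measurableSet_Ioi]
    · simp
    · intro s hs
      have : s ∉ G := fun h => absurd (hGj h : s ≤ 1) (not_le.2 (lt_of_le_of_lt ht hs))
      simp [indicator_of_notMem this]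

lemma norm_hardy_indicator {m n : ℕ} (hm : 1 ≤ m) (hmn : m < n) {ρ : (ℝ → ℝ≥0∞) → ℝ≥0∞}
    (hY : IsRINorm ρ) {K : ℝ≥0∞}
    (hK : ∀ t : ℝ, 1 ≤ t → ρ ((Ioo (0:ℝ) t).indicator 1) ≤
      K * ENNReal.ofReal (t ^ (1 - (m : ℝ)/(n : ℝ))))
    {F : Set ℝ} (hF : MeasurableSet F) :
    ρ (hardyOp m n (F.indicator 1)) ≤
      (∫⁻ s in Ioc (0:ℝ) 1, ENNReal.ofReal (s ^ ((m : ℝ)/(n : ℝ) - 1))) *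
        ρ ((Ioo (0:ℝ) 1).indicator 1) + 2 * K * mu0 F := by
  set c0 := (∫⁻ s in Ioc (0:ℝ) 1, ENNReal.ofReal (s ^ ((m : ℝ)/(n : ℝ) - 1))) *
        ρ ((Ioo (0:ℝ) 1).indicator 1) with hc0
  have key : ∀ k : ℕ, ρ (hardyOp m n ((F ∩ Iic ((k:ℝ) + 1)).indicator 1)) ≤
      c0 + 2 * K * mu0 (F ∩ Ioc 1 ((k:ℝ) + 1)) := by
    intro k
    induction k with
    | zero =>
      refine (norm_hardy_near_zero hm hmn hY (G := F ∩ Iic (((0:ℕ):ℝ) + 1)) ?_).trans le_self_add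
      simp
    | succ k ih =>
      have hdis : Disjoint (Iic ((k:ℝ) + 1)) (Ioc ((k:ℝ) + 1) ((k:ℝ) + 1 + 1)) :=
        disjoint_left.2 fun x hx hx2 => absurd (hx : x ≤ (k:ℝ) + 1) (not_le.2 hx2.1)
      have hU : F ∩ Iic (((k + 1 : ℕ):ℝ) + 1) =
          (F ∩ Iic ((k:ℝ) + 1)) ∪ (F ∩ Ioc ((k:ℝ) + 1) ((k:ℝ) + 1 + 1)) := by
        rw [← inter_union_distrib_left, Iic_union_Ioc_eq_Iic (by linarith)]
        push_cast; rfl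
      have hU2 : F ∩ Ioc 1 (((k + 1 : ℕ):ℝ) + 1) =
          (F ∩ Ioc 1 ((k:ℝ) + 1)) ∪ (F ∩ Ioc ((k:ℝ) + 1) ((k:ℝ) + 1 + 1)) := by
        rw [← inter_union_distrib_left, Ioc_union_Ioc_eq_Ioc (by simp) (by linarith)]
        push_cast; rfl
      have hind : (F ∩ Iic (((k + 1 : ℕ):ℝ) + 1)).indicator (1 : ℝ → ℝ≥0∞) =
          (F ∩ Iic ((k:ℝ) + 1)).indicator 1 +
          (F ∩ Ioc ((k:ℝ) + 1) ((k:ℝ) + 1 + 1)).indicator 1 := by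
        rw [hU, indicator_union_of_disjoint (hdis.mono inter_subset_right inter_subset_right)]
        rfl
      have hm2 : mu0 (F ∩ Ioc ((k:ℝ) + 1) ((k:ℝ) + 1 + 1)) ≠ ∞ :=
        measure_ne_top_of_subset inter_subset_right
          (by rw [mu0_Ioc (by positivity)]; simp)
      rw [hind, hardyOp_add m n (measurable_one.indicator (hF.inter measurableSet_Iic)), hU2,
        measure_union ((hdis.mono (inter_subset_right.trans Ioc_subset_Iic_self)
          inter_subset_right)) (hF.inter measurableSet_Ioc), mul_add, ← add_assoc]
      refine (hY.triangle _ _ (hardyOp_measurable m n _) (hardyOp_measurable m n _)).trans ?_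
      exact add_le_add ih (norm_hardy_piece hm hmn hY hK (hF.inter measurableSet_Ioc) hm2
        (by simp) inter_subset_right)
  have hle : ∀ j : ℕ, Iic ((j:ℝ) + 1) ⊆ Iic (((j + 1 : ℕ):ℝ) + 1) := fun j =>
    Iic_subset_Iic.2 (by push_cast; linarith)
  rw [← norm_hardy_iSup m n hY (F := fun k : ℕ => (F ∩ Iic ((k:ℝ) + 1)).indicator 1)
    (fun j => measurable_one.indicator (hF.inter measurableSet_Iic))]
  · refine iSup_le fun k => (key k).trans ?_
    gcongr
    exact inter_subset_left
  · intro j t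
    exact indicator_le_indicator_of_subset (inter_subset_inter_right _ (hle j))
      (fun _ => bot_le) t
  · intro t
    refine le_antisymm (iSup_le fun j => indicator_le_indicator_of_subset inter_subset_left
      (fun _ => bot_le) t) ?_
    obtain ⟨N, hN⟩ := exists_nat_ge t
    refine le_iSup_of_le N ?_
    by_cases ht : t ∈ F
    · have : t ∈ F ∩ Iic ((N:ℝ) + 1) := ⟨ht, by simp only [mem_Iic]; linarith⟩
      rw [indicator_of_mem this, indicator_of_mem ht]
    · simp [indicator_of_notMem ht]

lemma tauFun_isRINorm {m n : ℕ} (hm : 1 ≤ m) (hmn : m < n) {ρ : (ℝ → ℝ≥0∞) → ℝ≥0∞}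
    (hY : IsRINorm ρ) {K : ℝ≥0∞} (hKt : K ≠ ∞)
    (hK : ∀ t : ℝ, 1 ≤ t → ρ ((Ioo (0:ℝ) t).indicator 1) ≤
      K * ENNReal.ofReal (t ^ (1 - (m : ℝ)/(n : ℝ)))) : IsRINorm (tauFun m n ρ) := by
  have hmono : ∀ f g : ℝ → ℝ≥0∞, (∀ᵐ t ∂mu0, f t ≤ g t) → tauT m n ρ f ≤ tauT m n ρ g := by
    intro f g hfg
    refine iSup₂_le fun T hT => (norm_hardy_mono m n hY ?_).trans (le_tauT m n ρ g hT)
    exact hT.quasiMeasurePreserving.ae hfg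
  refine ⟨?_, ?_, ?_, ?_, ?_, ?_, ?_, ?_⟩
  · intro f hf
    rw [tauFun_eq m n hY hf]
    constructor
    · intro h0
      have h1 : ∀ k : ℕ, ∀ᵐ t ∂mu0, t ∈ Iic (k:ℝ) → f t = 0 := by
        intro k
        obtain ⟨C, -, -, hC⟩ := tauT_local hm hmn hY (measurableSet_Iic (a := (k:ℝ)))
          (by rw [mu0_Iic]; simp)
        have h2 := hC f hf
        rw [h0, mul_zero] at h2
        have h3 := (lintegral_eq_zero_iff hf).1 (le_antisymm h2 bot_le)
        exact (ae_restrict_iff' measurableSet_Iic).1 h3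
      filter_upwards [ae_all_iff.2 h1] with t ht
      obtain ⟨k, hk⟩ := exists_nat_ge t
      exact ht k hk
    · intro h0
      refine le_antisymm (iSup₂_le fun T hT => ?_) bot_le
      have h1 : ∀ᵐ x ∂mu0, f (T x) ≤ (fun _ => (0:ℝ≥0∞)) x := by
        have := hT.quasiMeasurePreserving.ae h0
        filter_upwards [this] with x hx
        simp [hx]
      refine (norm_hardy_mono m n hY h1).trans ?_
      refine ((hY.eq_zero_iff _ (hardyOp_measurable m n _)).2 ?_).le
      exact Eventually.of_forall fun t => by simp [hardyOp]
  · intro c f hf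
    rw [tauFun_eq m n hY hf, tauFun_eq m n hY (hf.const_mul _)]
    unfold tauT
    simp only [ENNReal.mul_iSup]
    refine iSup_congr fun T => iSup_congr fun hT => ?_
    rw [hardyOp_smul m n c (f := fun x => f (T x)) (hf.comp hT.measurable),
      hY.smul c _ (hardyOp_measurable m n _)]
  · intro f g hf hg
    rw [tauFun_eq m n hY hf, tauFun_eq m n hY hg, tauFun_eq m n hY (hf.add hg)]
    refine iSup₂_le fun T hT => ?_
    have : (fun x => (f + g) (T x)) = (fun x => f (T x)) + (fun x => g (T x)) := rfl
    rw [this, hardyOp_add m n (f := fun x => f (T x)) (hf.comp hT.measurable)]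
    exact (hY.triangle _ _ (hardyOp_measurable m n _) (hardyOp_measurable m n _)).trans
      (add_le_add (le_tauT m n ρ f hT) (le_tauT m n ρ g hT))
  · intro f g hf hg hfg
    rw [tauFun_eq m n hY hf, tauFun_eq m n hY hg]
    exact hmono f g hfg
  · intro F f hF hf hmonoF hsup
    rw [tauFun_eq m n hY hf]
    simp only [fun j => tauFun_eq m n hY (hF j)]
    unfold tauT
    rw [iSup_comm]
    refine iSup_congr fun T => ?_
    rw [iSup_comm]
    refine iSup_congr fun hT => ?_
    exact norm_hardy_iSup m n hY (F := fun j x => F j (T x)) (fun j => (hF j).comp hT.measurable)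
      (fun j t => hmonoF j (T t)) (fun t => hsup (T t))
  · intro E hE hEf
    rw [tauFun_eq m n hY (measurable_one.indicator hE)]
    refine lt_of_le_of_lt (b := (∫⁻ s in Ioc (0:ℝ) 1, ENNReal.ofReal (s ^ ((m : ℝ)/(n : ℝ) - 1))) *
        ρ ((Ioo (0:ℝ) 1).indicator 1) + 2 * K * mu0 E) (iSup₂_le fun T hT => ?_) ?_
    · have h1 := norm_hardy_indicator hm hmn hY hK (hT.measurable hE)
      rw [hT.measure_preimage hE.nullMeasurableSet] at h1
      exact h1
    · refine ENNReal.add_lt_top.2 ⟨ENNReal.mul_lt_top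
        (weight_integral_ne_top (exponent_bounds hm hmn).1).lt_top (norm_ind_ne_top hY 1).lt_top,
        ENNReal.mul_lt_top (ENNReal.mul_lt_top (by simp) hKt.lt_top) hEf⟩
  · intro E hE hEf
    obtain ⟨C, h1, h2, h3⟩ := tauT_local hm hmn hY hE hEf
    refine ⟨C, h1, h2, fun f hf => ?_⟩
    rw [tauFun_eq m n hY hf]
    exact h3 f hf
  · intro f g _ _ hfg
    unfold tauFun
    rw [hfg]

lemma rearr_indicator {A B : Set ℝ} (h : mu0 A = mu0 B) :
    rearr (A.indicator 1) = rearr (B.indicator 1) := by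
  have key : ∀ (E : Set ℝ) (l : ℝ≥0∞), mu0 {x | l < E.indicator (1 : ℝ → ℝ≥0∞) x} =
      if l < 1 then mu0 E else 0 := by
    intro E l
    split_ifs with hl
    · congr 1
      ext x
      by_cases hx : x ∈ E <;> simp [hx, hl]
    · have : {x | l < E.indicator (1 : ℝ → ℝ≥0∞) x} = ∅ := by
        ext x
        by_cases hx : x ∈ E <;> simp [hx, not_lt.1 hl]
      rw [this, measure_empty]
  funext t
  unfold rearr rearrangement
  simp only [key, h]

lemma no_domain {m n : ℕ} (hm : 1 ≤ m) (hmn : m < n) {ρ : (ℝ → ℝ≥0∞) → ℝ≥0∞}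
    (hY : IsRINorm ρ) (hex : ExistsRIDomain m n ρ) :
    0 < ⨅ (t : ℝ) (_ : 1 ≤ t),
        ENNReal.ofReal (t ^ (1 - (m : ℝ)/(n : ℝ))) / ρ ((Set.Ioo (0:ℝ) t).indicator 1) := by
  obtain ⟨hp0, hp1⟩ := exponent_bounds hm hmn
  obtain ⟨ρX, C, hX, -, hC, hle⟩ := hex
  set M := C * ρX ((Ioc (0:ℝ) 1).indicator 1) + 1 with hM
  have hMt : M ≠ ∞ := by
    refine ENNReal.add_ne_top.2 ⟨ENNReal.mul_ne_top hC.ne ?_, ENNReal.one_ne_top⟩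
    exact (hX.indicator_lt_top _ measurableSet_Ioc (by rw [mu0_Ioc le_rfl]; simp)).ne
  have hM0 : M ≠ 0 := by simp [hM]
  have h2M : 2 * M ≠ ∞ := ENNReal.mul_ne_top (by simp) hMt
  have h2M0 : 2 * M ≠ 0 := mul_ne_zero (by simp) hM0
  refine lt_of_lt_of_le (ENNReal.inv_pos.2 h2M) (le_iInf₂ fun t ht => ?_)
  have ht0 : 0 < t := by linarith
  rw [ENNReal.le_div_iff_mul_le (Or.inl (norm_ind_pos hY ht0)) (Or.inl (norm_ind_ne_top hY t))]
  set φ := ρ ((Ioo (0:ℝ) t).indicator 1) with hφ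
  have h1 : ENNReal.ofReal ((t + 1) ^ ((m : ℝ)/(n : ℝ) - 1)) * φ ≤ M := by
    have h2 := hle ((Ioc t (t + 1)).indicator 1) (measurable_one.indicator measurableSet_Ioc)
    have h3 : ρX ((Ioc t (t + 1)).indicator 1) = ρX ((Ioc (0:ℝ) 1).indicator 1) := by
      refine hX.rearr_inv _ _ (measurable_one.indicator measurableSet_Ioc)
        (measurable_one.indicator measurableSet_Ioc) (rearr_indicator ?_)
      rw [mu0_Ioc ht0.le, mu0_Ioc le_rfl]; simp
    rw [h3] at h2
    refine le_trans (mul_norm_ind_le hY (hardyOp_measurable m n _) fun s hs => ?_)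
      (h2.trans le_self_add)
    have h4 := hardyOp_ge hm hmn ((Ioc t (t + 1)).indicator 1) (b := t + 1) ht0 hs.2.le
    refine le_trans ?_ h4
    rw [setLIntegral_congr_fun (g := fun _ => 1) measurableSet_Ioc
      (fun x hx => by simp only [indicator_of_mem hx, Pi.one_apply])]
    rw [setLIntegral_one, mu0_Ioc ht0.le]
    simp
  rw [ENNReal.inv_mul_le_iff h2M0 h2M]
  calc φ = (ENNReal.ofReal ((t + 1) ^ ((m : ℝ)/(n : ℝ) - 1)) * φ) *
        ENNReal.ofReal ((t + 1) ^ (1 - (m : ℝ)/(n : ℝ))) := by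
        rw [mul_right_comm, weight_mul (by linarith), one_mul]
    _ ≤ M * (2 * ENNReal.ofReal (t ^ (1 - (m : ℝ)/(n : ℝ)))) := by
        gcongr
        exact pow_double hp0.le hp1 ht
    _ = _ := by ring

/-- optimal domain space. -/
theorem statement7 (n m : ℕ) (hn : 2 ≤ n) (hm : 1 ≤ m) (hmn : m < n)
    (ρY : (ℝ → ℝ≥0∞) → ℝ≥0∞) (hY : IsRINorm ρY) :
    ((0 < ⨅ (t : ℝ) (_ : 1 ≤ t),
        ENNReal.ofReal (t ^ (1 - (m : ℝ)/(n : ℝ))) / ρY ((Set.Ioo (0:ℝ) t).indicator 1)) →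
      IsRINorm (tauFun m n ρY)
      ∧ (∀ f : ℝ → ℝ≥0∞, Measurable f → ρY (hardyOp m n f) ≤ tauFun m n ρY f)
      ∧ (∀ ρZ : (ℝ → ℝ≥0∞) → ℝ≥0∞, IsRINorm ρZ → ∀ C : ℝ≥0∞,
          (∀ f : ℝ → ℝ≥0∞, Measurable f → ρY (hardyOp m n f) ≤ C * ρZ f) →
          ∀ f : ℝ → ℝ≥0∞, Measurable f → tauFun m n ρY f ≤ C * ρZ f))
    ∧
    ((⨅ (t : ℝ) (_ : 1 ≤ t),
        ENNReal.ofReal (t ^ (1 - (m : ℝ)/(n : ℝ))) / ρY ((Set.Ioo (0:ℝ) t).indicator 1)) = 0 →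
      ¬ ExistsRIDomain m n ρY) := by
  refine ⟨fun hpos => ⟨?_, ?_, ?_⟩, fun h0 hex => ?_⟩
  · set κ := ⨅ (t : ℝ) (_ : 1 ≤ t),
        ENNReal.ofReal (t ^ (1 - (m : ℝ)/(n : ℝ))) / ρY ((Set.Ioo (0:ℝ) t).indicator 1) with hκ
    have hκle : ∀ t : ℝ, 1 ≤ t → κ * ρY ((Set.Ioo (0:ℝ) t).indicator 1) ≤
        ENNReal.ofReal (t ^ (1 - (m : ℝ)/(n : ℝ))) := by
      intro t ht
      rw [← ENNReal.le_div_iff_mul_le (Or.inl (norm_ind_pos hY (by linarith)))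
        (Or.inl (norm_ind_ne_top hY t))]
      exact iInf₂_le t ht
    have hκt : κ ≠ ∞ := by
      intro h
      have h1 := hκle 1 le_rfl
      rw [h, ENNReal.top_mul (norm_ind_pos hY one_pos)] at h1
      exact absurd h1 (by simp)
    refine tauFun_isRINorm hm hmn hY (K := κ⁻¹) (ENNReal.inv_ne_top.2 hpos.ne') fun t ht => ?_
    have h2 := hκle t ht
    rw [← ENNReal.inv_mul_le_iff (ENNReal.inv_ne_zero.2 hκt) (ENNReal.inv_ne_top.2 hpos.ne'),
      inv_inv]
    exact h2
  · intro f hf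
    exact le_iSup_of_le f (le_iSup₂_of_le hf rfl le_rfl)
  · intro ρZ hZ C hC f hf
    refine iSup_le fun h => iSup₂_le fun hh hr => ?_
    rw [← hZ.rearr_inv h f hh hf hr]
    exact hC h hh
  · exact (no_domain hm hmn hY hex).ne' h0

end
end
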